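/- arXiv:2006.05326 — 3 statements merged into one kernel-verified Lean document; each statement's English description precedes it below -/
import Mathlib

section
/- Let S = Q(5,q) with full subquadrangle S' ≅ Q(4,q), so that the geometry E of elliptic (subtended) ovoids and rosettes is a semi partial geometry. Then its parameters are s* = q−1, t* = q², α* = 2, μ* = 2q(q−1). -/
/-- Two points are collinear if they are incident with a common line. -/
def Collin {P L : Type} (inc : P → L → Prop) (x y : P) : Prop :=
  ∃ M, inc x M ∧ inc y M

/-- `inc` is the incidence relation of a generalized quadrangle:
two distinct points lie on at most one common line, for every non-incident
point-line pair `(x,l)` there is a unique point of `l` collinear with `x`,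
and (from the order axiom) every point is on a line and every line has a point. -/
def IsGQ {P L : Type} (inc : P → L → Prop) : Prop :=
  (∀ p q : P, ∀ l m : L, p ≠ q → inc p l → inc q l → inc p m → inc q m → l = m) ∧
  (∀ (x : P) (l : L), ¬ inc x l → ∃! y : P, inc y l ∧ Collin inc x y) ∧
  (∀ p : P, ∃ l, inc p l) ∧ (∀ l : L, ∃ p, inc p l)

/-- The incidence relation of the subgeometry induced on a set of points and
a set of lines. -/
def Rinc {P L : Type} (inc : P → L → Prop) (SP : Set P) (SL : Set L) :
    ↥SP → ↥SL → Prop :=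
  fun p l => inc p.1 l.1

/-- The subgeometry `(SP, SL)` is full: every point of the ambient geometry
incident with one of its lines belongs to it. -/
def IsFull {P L : Type} (inc : P → L → Prop) (SP : Set P) (SL : Set L) : Prop :=
  ∀ l ∈ SL, ∀ p, inc p l → p ∈ SP

/-- A set of points is an ovoid: every line is incident with exactly one of its
points. -/
def IsOvoid {P L : Type} (inc : P → L → Prop) (O : Set P) : Prop :=
  ∀ l : L, ∃! p, p ∈ O ∧ inc p l

/-- A geometry is thick if every point is incident with at least 3 lines and
every line is incident with at least 3 points. -/
def Thick {P L : Type} (inc : P → L → Prop) : Prop :=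
  (∀ p : P, ∃ l m n : L, l ≠ m ∧ l ≠ n ∧ m ≠ n ∧ inc p l ∧ inc p m ∧ inc p n) ∧
  (∀ l : L, ∃ p q r : P, p ≠ q ∧ p ≠ r ∧ q ≠ r ∧ inc p l ∧ inc q l ∧ inc r l)

/-- The ovoid of `S' = (SP, ·)` subtended by the exterior point `x`:
the points of `SP` collinear with `x`. -/
def subtend {P L : Type} (inc : P → L → Prop) (SP : Set P) (x : P) : Set P :=
  {p | p ∈ SP ∧ Collin inc x p}

/-- The points of the geometry `E`: the ovoids of `S'` subtended by points of
`S` outside `S'`. -/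
def EPoints {P L : Type} (inc : P → L → Prop) (SP : Set P) : Set (Set P) :=
  {O | ∃ x, x ∉ SP ∧ O = subtend inc SP x}

/-- The lines of the geometry `E`: the rosettes of subtended ovoids, one for
each line of `S` meeting `S'` in exactly one point. -/
def ELines {P L : Type} (inc : P → L → Prop) (SP : Set P) : Set (Set (Set P)) :=
  {R | ∃ l : L, (∃! p, inc p l ∧ p ∈ SP) ∧
    R = {O | ∃ y, y ∉ SP ∧ inc y l ∧ O = subtend inc SP y}}

/-- `(pts, lns)` (with incidence given by membership) is a semi partial
geometry with parameters `(s*, t*, α*, μ*)`. -/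
def IsSPG {X : Type} (pts : Set X) (lns : Set (Set X))
    (sstar tstar astar mustar : ℕ) : Prop :=
  (∀ x ∈ pts, {R | R ∈ lns ∧ x ∈ R}.ncard = tstar + 1) ∧
  (∀ x ∈ pts, ∀ y ∈ pts, x ≠ y →
    ∀ R ∈ lns, ∀ R' ∈ lns, x ∈ R → y ∈ R → x ∈ R' → y ∈ R' → R = R') ∧
  (∀ R ∈ lns, R ⊆ pts ∧ R.ncard = sstar + 1) ∧
  (∀ R ∈ lns, ∀ R' ∈ lns, R ≠ R' → Set.Subsingleton (R ∩ R')) ∧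
  (∀ x ∈ pts, ∀ R ∈ lns, x ∉ R →
    {y | y ∈ R ∧ ∃ R' ∈ lns, x ∈ R' ∧ y ∈ R'}.ncard = 0 ∨
    {y | y ∈ R ∧ ∃ R' ∈ lns, x ∈ R' ∧ y ∈ R'}.ncard = astar) ∧
  (∀ x ∈ pts, ∀ y ∈ pts, x ≠ y → ¬ (∃ R ∈ lns, x ∈ R ∧ y ∈ R) →
    {z | z ∈ pts ∧ (∃ R ∈ lns, z ∈ R ∧ x ∈ R) ∧ (∃ R ∈ lns, z ∈ R ∧ y ∈ R)}.ncard
      = mustar)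

open Finset

section aux
open scoped Classical
set_option linter.unusedSectionVars false
variable {P L : Type} [Fintype P] [Fintype L] {inc : P → L → Prop}

theorem aux_ncard {X : Type} [Fintype X] (p : X → Prop) :
    {x | p x}.ncard = #{x | p x} := by
  rw [Set.ncard_eq_toFinset_card']
  congr 1
  ext; simp

theorem Collin.symm' {x y : P} (h : Collin inc x y) : Collin inc y x := by
  obtain ⟨m, h1, h2⟩ := h
  exact ⟨m, h2, h1⟩

theorem IsGQ.refl' (h : IsGQ inc) (x : P) : Collin inc x x := by
  obtain ⟨m, hm⟩ := h.2.2.1 x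
  exact ⟨m, hm, hm⟩

/-- no triangles -/
theorem IsGQ.tri (h : IsGQ inc) {x y z : P} {l : L} (hx : inc x l) (hy : inc y l) (hxy : x ≠ y)
    (hzx : Collin inc z x) (hzy : Collin inc z y) : inc z l := by
  by_contra hz
  obtain ⟨w, -, hw⟩ := h.2.1 z l hz
  exact hxy ((hw x ⟨hx, hzx⟩).trans (hw y ⟨hy, hzy⟩).symm)

/-- points on a pencil of lines -/
theorem IsGQ.pencil (h : IsGQ inc) {s : ℕ} (hs : ∀ l : L, #{p | inc p l} = s + 1)
    (a : P) (M : Finset L) (hM : ∀ m ∈ M, inc a m) :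
    #{x | x ≠ a ∧ ∃ m ∈ M, inc x m} = #M * s := by
  have e : (univ.filter fun x => x ≠ a ∧ ∃ m ∈ M, inc x m)
      = M.biUnion (fun m => (univ.filter fun x => inc x m).erase a) := by
    ext x; simp; tauto
  rw [e, card_biUnion, sum_const_nat]
  · intro m hm
    rw [card_erase_of_mem (by simpa using hM m hm), hs]; rfl
  · intro m hm m' hm' hne
    rw [Function.onFun, disjoint_left]
    intro x hx hx'
    simp at hx hx'
    exact hne (h.1 x a m m' hx.1 hx.2 (hM m hm) hx'.2 (hM m' hm'))

theorem IsGQ.card_perp (h : IsGQ inc) {s t : ℕ} (hs : ∀ l : L, #{p | inc p l} = s + 1)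
    (ht : ∀ p : P, #{l | inc p l} = t + 1) (a : P) :
    #{x | Collin inc a x} = 1 + (t + 1) * s := by
  have := h.pencil hs a (univ.filter fun l => inc a l) (by simp)
  rw [ht] at this
  rw [← this]
  have e : (univ.filter fun x => Collin inc a x) = insert a
     (univ.filter fun x => x ≠ a ∧ ∃ m ∈ (univ.filter fun l => inc a l), inc x m) := by
    ext x
    simp only [mem_filter, mem_univ, true_and, mem_insert]
    by_cases hx : x = a
    · subst hx; simp [h.refl']
    · simp [hx, Collin]
  rw [e, card_insert_of_notMem (by simp), add_comm]
  congr!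

theorem IsGQ.card_points (h : IsGQ inc) {s t : ℕ} (hs : ∀ l : L, #{p | inc p l} = s + 1)
    (ht : ∀ p : P, #{l | inc p l} = t + 1) (l : L) :
    Fintype.card P = (s + 1) * (1 + s * t) := by
  have e : (univ : Finset P) = (univ.filter fun p => inc p l) ∪
     (univ.filter fun p => inc p l).biUnion (fun a => univ.filter fun x =>
       x ≠ a ∧ ∃ m ∈ (univ.filter fun m => inc a m).erase l, inc x m) := by
    ext x
    simp only [mem_univ, mem_union, mem_filter, true_and, mem_biUnion, mem_erase, true_iff]
    by_cases hx : inc x l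
    · exact Or.inl hx
    · right
      obtain ⟨y, ⟨hy, m, h1, h2⟩, -⟩ := h.2.1 x l hx
      refine ⟨y, hy, ?_, m, ⟨?_, h2⟩, h1⟩
      · rintro rfl; exact hx hy
      · rintro rfl; exact hx h1
  rw [← card_univ, e, card_union_of_disjoint, card_biUnion, hs, sum_const_nat (m := t * s), hs]
  · ring
  · intro a ha
    simp only [mem_filter, mem_univ, true_and] at ha
    have h1 := h.pencil hs a ((univ.filter fun m => inc a m).erase l) (by simp)
    rw [card_erase_of_mem (by simpa using ha), ht, Nat.add_sub_cancel] at h1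
    rw [← h1]
    congr!
  · intro a ha b hb hab
    rw [Function.onFun, disjoint_left]
    intro x hx hx'
    simp at ha hb hx hx'
    obtain ⟨hxa, m, ⟨hml, ham⟩, hxm⟩ := hx
    obtain ⟨hxb, m', ⟨hml', hbm'⟩, hxm'⟩ := hx'
    have := h.tri ha hb hab ⟨m, hxm, ham⟩ ⟨m', hxm', hbm'⟩
    exact hml (h.1 x a m l hxa hxm ham this ha)
  · rw [disjoint_left]
    intro x hx hx'
    simp at hx hx'
    obtain ⟨a, hal, hxa, m, ⟨hml, ham⟩, hxm⟩ := hx'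
    exact hml (h.1 x a m l hxa hxm ham hx hal)

theorem IsGQ.card_common (h : IsGQ inc) {t : ℕ} 
    (ht : ∀ p : P, #{l | inc p l} = t + 1) {x y : P} (hxy : ¬ Collin inc x y) :
    #{z | Collin inc x z ∧ Collin inc y z} = t + 1 := by
  rw [← ht x]
  have key : ∀ l, inc x l → ∃ z, inc z l ∧ Collin inc y z := by
    intro l hl
    obtain ⟨z, hz, -⟩ := h.2.1 y l (fun hy => hxy ⟨l, hl, hy⟩)
    exact ⟨z, hz⟩
  have : Nonempty P := ⟨x⟩
  choose! f hf1 hf2 using key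
  symm
  apply card_bij (fun l _ => f l)
  · intro l hl
    simp at hl ⊢
    exact ⟨⟨l, hl, hf1 l hl⟩, hf2 l hl⟩
  · intro l hl m hm e
    simp at hl hm
    have hne : x ≠ f l := by
      intro e'
      have := hf2 l hl
      rw [← e'] at this
      exact hxy this.symm'
    exact h.1 x (f l) l m hne hl (hf1 l hl) hm (e ▸ hf1 m hm)
  · intro z hz
    simp at hz
    obtain ⟨⟨l, hxl, hzl⟩, hyz⟩ := hz
    refine ⟨l, by simpa using hxl, ?_⟩
    by_contra hne
    exact hxy ⟨l, hxl, h.tri (hf1 l hxl) hzl hne (hf2 l hxl) hyz⟩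

/-- Bose–Shrikhande: triads in a GQ of order (q,q²) have q+1 centres -/
theorem IsGQ.triad (h : IsGQ inc) {q : ℕ} (hq : 2 ≤ q) (hs : ∀ l : L, #{p | inc p l} = q + 1)
    (ht : ∀ p : P, #{l | inc p l} = q * q + 1) {x x' y : P} (hx : ¬ Collin inc x x')
    (hxy : ¬ Collin inc x y) (hxy' : ¬ Collin inc x' y) :
    #{z | (Collin inc x z ∧ Collin inc x' z) ∧ Collin inc y z} = q + 1 := by
  set T := univ.filter fun z => Collin inc x z ∧ Collin inc x' z with hT
  set Y := univ.filter fun y => ¬ Collin inc x y ∧ ¬ Collin inc x' y with hY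
  have cT : #T = q * q + 1 := h.card_common ht hx
  have cY : (#Y : ℤ) = q * (q - 1) * (q * q + 1) := by
    have h1 := h.card_perp hs ht x
    have h2 := h.card_perp hs ht x'
    obtain ⟨l, -⟩ := h.2.2.1 x
    have h3 := h.card_points hs ht l
    have h4 := card_union_add_card_inter (univ.filter fun z => Collin inc x z)
      (univ.filter fun z => Collin inc x' z)
    have h5 := card_filter_add_card_filter_not (s := (univ : Finset P))
      (fun z => Collin inc x z ∨ Collin inc x' z)
    rw [← filter_and, ← hT, ← filter_or, h1, h2, cT] at h4
    simp only [not_or] at h5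
    rw [← hY, card_univ, h3] at h5
    zify at h4 h5
    linear_combination h5 - h4
  have S1 : ∀ c ∈ T, #{y ∈ Y | Collin inc y c} = (q * q - 1) * q := by
    intro c hc
    simp [hT] at hc
    obtain ⟨⟨m, hxm, hcm⟩, ⟨m', hxm', hcm'⟩⟩ := hc
    have hcx : x ≠ c := by rintro rfl; exact hx ⟨m', hcm', hxm'⟩
    have hcx' : x' ≠ c := by rintro rfl; exact hx ⟨m, hxm, hcm⟩
    have hne : m ≠ m' := by rintro rfl; exact hx ⟨m, hxm, hxm'⟩
    have := h.pencil hs c (((univ.filter fun l => inc c l).erase m).erase m') (by simp)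
    rw [card_erase_of_mem (by simpa [hne.symm] using hcm'), card_erase_of_mem (by simpa using hcm),
      ht] at this
    rw [show q * q - 1 = q * q + 1 - 1 - 1 from rfl, ← this]
    congr 1
    ext z
    simp only [hY, mem_filter, mem_univ, true_and, mem_erase]
    constructor
    · rintro ⟨⟨h1, h2⟩, k, hzk, hck⟩
      refine ⟨?_, k, ⟨?_, ?_, hck⟩, hzk⟩
      · rintro rfl; exact h1 ⟨m, hxm, hcm⟩
      · rintro rfl; exact h2 ⟨k, hxm', hzk⟩
      · rintro rfl; exact h1 ⟨k, hxm, hzk⟩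
    · rintro ⟨hzc, k, ⟨h1, h2, hck⟩, hzk⟩
      refine ⟨⟨?_, ?_⟩, k, hzk, hck⟩
      · intro hc
        have := h.tri hzk hck hzc hc ⟨m, hxm, hcm⟩
        exact h2 (h.1 x c k m hcx this hck hxm hcm)
      · intro hc
        have := h.tri hzk hck hzc hc ⟨m', hxm', hcm'⟩
        exact h1 (h.1 x' c k m' hcx' this hck hxm' hcm')
  have S2 : ∀ c ∈ T, ∀ c' ∈ T.erase c,
      #{y ∈ Y | Collin inc y c ∧ Collin inc y c'} = q * q - 1 := by
    intro c hc c' hc'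
    simp [hT] at hc hc'
    obtain ⟨hcc, hxc', hx'c'⟩ := hc'
    obtain ⟨hxc, hx'c⟩ := hc
    have hncc : ¬ Collin inc c c' := by
      rintro ⟨k, h1, h2⟩
      exact hx ⟨k, h.tri h1 h2 (Ne.symm hcc) hxc hxc', h.tri h1 h2 (Ne.symm hcc) hx'c hx'c'⟩
    have hxx : x' ≠ x := by rintro rfl; exact hx (h.refl' _)
    have hcom := h.card_common ht hncc
    have aux : ∀ w z, Collin inc w c → Collin inc w c' → Collin inc z c → Collin inc z c' →
        Collin inc w z → z = w := by
      rintro w z h1 h2 h3 h4 ⟨k, hw, hz⟩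
      by_contra hne
      exact hncc ⟨k, h.tri hz hw hne h3.symm' h1.symm', h.tri hz hw hne h4.symm' h2.symm'⟩
    have e : {y ∈ Y | Collin inc y c ∧ Collin inc y c'} =
        ((univ.filter fun z => Collin inc c z ∧ Collin inc c' z).erase x).erase x' := by
      ext z
      simp only [hY, mem_filter, mem_univ, true_and, mem_erase]
      constructor
      · rintro ⟨⟨h1, h2⟩, h3, h4⟩
        refine ⟨?_, ?_, h3.symm', h4.symm'⟩
        · rintro rfl; exact h2 (h.refl' _)
        · rintro rfl; exact h1 (h.refl' _)
      · rintro ⟨h1, h2, h3, h4⟩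
        refine ⟨⟨fun h5 => h2 ?_, fun h5 => h1 ?_⟩, h3.symm', h4.symm'⟩
        · exact aux x z hxc hxc' h3.symm' h4.symm' h5
        · exact aux x' z hx'c hx'c' h3.symm' h4.symm' h5
    rw [e, card_erase_of_mem, card_erase_of_mem, hcom]
    · rfl
    · simpa using ⟨hxc.symm', hxc'.symm'⟩
    · simpa [hxx] using ⟨hx'c.symm', hx'c'.symm'⟩
  let n : P → ℤ := fun y => ∑ c ∈ T, if Collin inc y c then 1 else 0
  have hq1 : 1 ≤ q * q := by nlinarith
  have T1 : ∑ y ∈ Y, n y = (q * q + 1) * ((q * q - 1) * q) := by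
    simp only [n]
    rw [sum_comm]
    have : ∀ c ∈ T, (∑ y ∈ Y, if Collin inc y c then (1 : ℤ) else 0) = (q * q - 1) * q := by
      intro c hc
      have := S1 c hc
      rw [sum_boole, this]; push_cast [hq1]; ring
    rw [sum_congr rfl this, sum_const, cT]; simp
  have T2 : ∑ y ∈ Y, n y * n y =
      (q * q + 1) * ((q * q - 1) * q + q * q * (q * q - 1)) := by
    simp only [n, sum_mul_sum]
    rw [sum_comm]
    have : ∀ c ∈ T, (∑ y ∈ Y, ∑ c' ∈ T, (if Collin inc y c then (1 : ℤ) else 0) *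
        (if Collin inc y c' then (1 : ℤ) else 0)) = (q * q - 1) * q + q * q * (q * q - 1) := by
      intro c hc
      rw [sum_comm, ← add_sum_erase _ _ hc]
      congr 1
      · have := S1 c hc
        simp only [mul_ite, mul_one, mul_zero]
        have e2 : ∀ y, (if Collin inc y c then (if Collin inc y c then (1 : ℤ) else 0) else 0)
          = if Collin inc y c then 1 else 0 := by intro y; split_ifs <;> rfl
        simp only [e2]
        rw [sum_boole, this]; push_cast [hq1]; ring
      · have e3 : ∀ c' ∈ T.erase c, (∑ y ∈ Y, (if Collin inc y c then (1 : ℤ) else 0) *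
          (if Collin inc y c' then (1 : ℤ) else 0)) = q * q - 1 := by
          intro c' hc'
          have := S2 c hc c' hc'
          have e2 : ∀ y, ((if Collin inc y c then (1 : ℤ) else 0) *
            (if Collin inc y c' then (1 : ℤ) else 0)) =
              if Collin inc y c ∧ Collin inc y c' then 1 else 0 := by
            intro y; split_ifs <;> simp_all
          simp only [e2]
          rw [sum_boole, this]; push_cast [hq1]; ring
        rw [sum_congr rfl e3, sum_const, card_erase_of_mem hc, cT]; simp
    rw [sum_congr rfl this, sum_const, cT]; simp
  have T3 : ∑ y ∈ Y, (n y - (q + 1)) ^ 2 = 0 := by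
    have : ∀ y, (n y - (q + 1)) ^ 2 = n y * n y - 2 * (q + 1) * n y + (q + 1) ^ 2 := by
      intro y; ring
    simp only [this]
    rw [sum_add_distrib, sum_sub_distrib, ← mul_sum, T1, T2, sum_const, nsmul_eq_mul, cY]
    ring
  rw [sum_eq_zero_iff_of_nonneg (fun _ _ => sq_nonneg _)] at T3
  have := T3 y (by simp [hY, hxy, hxy'])
  have h7 : n y = q + 1 := by
    have := pow_eq_zero_iff (two_ne_zero) |>.1 this
    linarith
  simp only [n] at h7
  rw [sum_boole] at h7
  rw [hT, filter_filter] at h7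
  exact_mod_cast h7


theorem sub_line (hGQ : IsGQ inc) {SP : Set P} {SL : Set L}
    (hsub : IsGQ (Rinc inc SP SL)) {p r : P} (hp : p ∈ SP) (hr : r ∈ SP) (hpr : p ≠ r) {l : L}
    (hpl : inc p l) (hrl : inc r l) : l ∈ SL := by
  obtain ⟨⟨m, hm⟩, hrm⟩ := hsub.2.2.1 ⟨r, hr⟩
  simp only [Rinc] at hrm
  by_cases hpm : inc p m
  · rw [hGQ.1 p r l m hpr hpl hrl hpm hrm]; exact hm
  · obtain ⟨⟨z, hz⟩, ⟨hzm, ⟨k, hk⟩, h1, h2⟩, -⟩ := hsub.2.1 ⟨p, hp⟩ ⟨m, hm⟩ hpm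
    simp only [Rinc] at hzm h1 h2
    have : z = r := by
      by_contra hne
      exact hpm (hGQ.tri hzm hrm hne ⟨k, h1, h2⟩ ⟨l, hpl, hrl⟩)
    subst this
    rw [hGQ.1 p z l k hpr hpl hrl h1 h2]; exact hk

theorem sub_unique (hGQ : IsGQ inc) {SP : Set P} {SL : Set L}
    (hsub : IsGQ (Rinc inc SP SL)) (hfull : IsFull inc SP SL) {x p r : P} (hx : x ∉ SP)
    (hp : p ∈ SP) (hr : r ∈ SP) {l : L} (hxl : inc x l)
    (hpl : inc p l) (hrl : inc r l) : p = r := by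
  by_contra hne
  exact hx (hfull l (sub_line hGQ hsub hp hr hne hpl hrl) x hxl)

theorem sub_exists (hGQ : IsGQ inc) {q : ℕ}
    (hs : ∀ l : L, #{p | inc p l} = q + 1)
    (ht : ∀ p : P, #{l | inc p l} = q * q + 1) {SP : Set P} {SL : Set L}
    (hsub : IsGQ (Rinc inc SP SL)) (hfull : IsFull inc SP SL)
    (hpoint' : ∀ p ∈ SP, {l | l ∈ SL ∧ inc p l}.ncard = q + 1) (hne : SP.Nonempty)
    {x : P} (hx : x ∉ SP) {l : L} (hxl : inc x l) : ∃ p ∈ SP, inc p l := by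
  have hs' : ∀ l : SL, #{p | Rinc inc SP SL p l} = q + 1 := by
    intro l
    rw [← hs l.1]
    apply card_bij (fun p _ => p.1)
    · intro p hp; exact mem_filter.2 ⟨mem_univ _, (mem_filter.1 hp).2⟩
    · intro p _ r _ e; exact Subtype.ext e
    · intro p hp
      simp at hp
      exact ⟨⟨p, hfull _ l.2 p hp⟩, mem_filter.2 ⟨mem_univ _, hp⟩, rfl⟩
  have ht' : ∀ p : SP, #{l | Rinc inc SP SL p l} = q + 1 := by
    intro p
    rw [← hpoint' p.1 p.2, aux_ncard]
    apply card_bij (fun p _ => p.1)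
    · intro l hl
      have h1 := (mem_filter.1 hl).2
      simp only [mem_filter, mem_univ, true_and]
      exact ⟨l.2, h1⟩
    · intro p _ r _ e; exact Subtype.ext e
    · intro l hl
      simp at hl
      exact ⟨⟨l, hl.1⟩, mem_filter.2 ⟨mem_univ _, hl.2⟩, rfl⟩
  obtain ⟨p0, hp0⟩ := hne
  obtain ⟨l0, -⟩ := hsub.2.2.1 ⟨p0, hp0⟩
  have cP := hsub.card_points hs' ht' l0
  have cL : Fintype.card SL * (q + 1) = Fintype.card SP * (q + 1) := by
    have := sum_card_bipartiteAbove_eq_sum_card_bipartiteBelow (s := (univ : Finset SP))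
      (t := (univ : Finset SL)) (Rinc inc SP SL)
    simp only [bipartiteAbove, bipartiteBelow] at this
    rw [sum_congr rfl (fun a _ => ht' a), sum_congr rfl (fun a _ => hs' a)] at this
    simpa using this.symm
  have cL2 := Nat.eq_of_mul_eq_mul_right (Nat.succ_pos q) cL
  set O : Finset SP := univ.filter fun p => Collin inc x p.1 with hO
  have cO : #O * (q + 1) = Fintype.card SL := by
    have := sum_card_bipartiteAbove_eq_sum_card_bipartiteBelow (s := O)
      (t := (univ : Finset SL)) (Rinc inc SP SL)
    simp only [bipartiteAbove, bipartiteBelow] at this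
    rw [sum_congr rfl (fun a _ => ht' a), sum_congr rfl (g := fun _ : SL => 1)] at this
    · simpa using this
    · intro m _
      have hxm : ¬ inc x m.1 := fun hh => hx (hfull _ m.2 _ hh)
      obtain ⟨y, ⟨h1, h2⟩, h3⟩ := hGQ.2.1 x m.1 hxm
      rw [card_eq_one]
      refine ⟨⟨y, hfull _ m.2 _ h1⟩, ?_⟩
      ext z
      simp only [hO, mem_filter, mem_univ, true_and, mem_singleton, Rinc]
      constructor
      · rintro ⟨h4, h5⟩; exact Subtype.ext (h3 _ ⟨h5, h4⟩)
      · rintro rfl; exact ⟨h2, h1⟩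
  have cO2 : #O = q * q + 1 := by
    rw [cL2, cP] at cO
    apply Nat.eq_of_mul_eq_mul_right (Nat.succ_pos q)
    rw [Nat.succ_eq_add_one, cO]; ring
  have key : ∀ p : SP, Collin inc x p.1 → ∃ l, inc x l ∧ inc p.1 l := fun p hp => hp
  have : Nonempty L := ⟨l⟩
  choose! f hf1 hf2 using key
  have hsurj := surj_on_of_inj_on_of_card_le (s := O) (t := univ.filter fun l => inc x l)
    (fun p _ => f p) (fun p hp => by simp [hO] at hp ⊢; exact hf1 p hp)
    (fun p r hp hr e => by
      simp [hO] at hp hr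
      exact Subtype.ext (sub_unique hGQ hsub hfull hx p.2 r.2 (hf1 p hp) (hf2 p hp)
        (e ▸ hf2 r hr)))
    (by rw [ht, cO2])
  obtain ⟨p, hp, e⟩ := hsurj l (by simpa using hxl)
  simp [hO] at hp
  exact ⟨p.1, p.2, e ▸ hf2 p hp⟩

end aux
/-- for `S = Q(5,q)` with full subquadrangle `S' ≅ Q(4,q)`
(a GQ of order `(q,q²)` with a full subquadrangle of order `(q,q)` in which
every subtended (elliptic) ovoid is subtended by exactly two exterior points),
the geometry `E` of subtended ovoids and rosettes is a semi partial geometry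
with parameters `s* = q-1`, `t* = q²`, `α* = 2`, `μ* = 2q(q-1)`. -/
theorem elliptic_ovoid_geometry_is_SPG {P L : Type} [Fintype P] [Fintype L]
    (inc : P → L → Prop) (q : ℕ) (hq : 2 ≤ q)
    (hGQ : IsGQ inc)
    (hline : ∀ l : L, {p | inc p l}.ncard = q + 1)
    (hpoint : ∀ p : P, {l | inc p l}.ncard = q * q + 1)
    (SP : Set P) (SL : Set L)
    (hsub : IsGQ (Rinc inc SP SL))
    (hfull : IsFull inc SP SL)
    (hpoint' : ∀ p ∈ SP, {l | l ∈ SL ∧ inc p l}.ncard = q + 1)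
    (hsub2 : ∀ x, x ∉ SP →
      {y | y ∉ SP ∧ subtend inc SP y = subtend inc SP x}.ncard = 2) :
    IsSPG (EPoints inc SP) (ELines (L := L) inc SP)
      (q - 1) (q * q) 2 (2 * q * (q - 1)) := by
  classical
  have hs : ∀ l : L, #{p | inc p l} = q + 1 := fun l => by rw [← aux_ncard]; convert hline l
  have ht : ∀ p : P, #{l | inc p l} = q * q + 1 := fun l => by rw [← aux_ncard]; convert hpoint l
  have hq4 : 4 ≤ q * q := by nlinarith
  have hne : ∀ x, x ∉ SP → SP.Nonempty := by
    intro x hx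
    by_contra hem
    rw [Set.not_nonempty_iff_eq_empty] at hem
    subst hem
    have h1 := hsub2 x hx
    obtain ⟨l, -⟩ := hGQ.2.2.1 x
    have h2 := Set.ncard_le_ncard (s := {p | inc p l})
      (t := {y | y ∉ (∅ : Set P) ∧ subtend inc ∅ y = subtend inc ∅ x})
      (by intro y _; simp [subtend]) (Set.toFinite _)
    rw [h1, hline] at h2
    omega
  have ex : ∀ x, x ∉ SP → ∀ l, inc x l → ∃ p ∈ SP, inc p l := fun x hx l hl =>
    sub_exists hGQ (by convert hs) (by convert ht) hsub hfull hpoint' (hne x hx) hx hl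
  have un : ∀ x, x ∉ SP → ∀ l, inc x l → ∀ p ∈ SP, ∀ r ∈ SP, inc p l → inc r l → p = r :=
    fun x hx l hl p hp r hr h1 h2 => sub_unique hGQ hsub hfull hx hp hr hl h1 h2
  let O := subtend inc SP
  let C := Collin inc
  have hO : ∀ x p, p ∈ O x ↔ p ∈ SP ∧ C x p := fun x p => Iff.rfl
  let Tw : P → P → Prop := fun x x' => x ∉ SP ∧ x' ∉ SP ∧ x ≠ x' ∧ O x = O x'
  have Csymm : ∀ {x y}, C x y → C y x := fun h => h.symm'
  have Twsymm : ∀ {x y}, Tw x y → Tw y x := fun h => ⟨h.2.1, h.1, h.2.2.1.symm, h.2.2.2.symm⟩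
  have twin : ∀ x, x ∉ SP → ∃ x', Tw x x' ∧ ∀ y, y ∉ SP → O y = O x → y = x ∨ y = x' := by
    intro x hx
    obtain ⟨a, b, hab, e⟩ := Set.ncard_eq_two.1 (hsub2 x hx)
    have ha : a ∈ ({a, b} : Set P) := by simp
    have hb : b ∈ ({a, b} : Set P) := by simp
    have hxm : x ∈ ({a, b} : Set P) := by rw [← e]; exact ⟨hx, rfl⟩
    rw [← e] at ha hb
    have hall : ∀ y, y ∉ SP → O y = O x → y = a ∨ y = b := by
      intro y h1 h2
      have : y ∈ ({a, b} : Set P) := by rw [← e]; exact ⟨h1, h2⟩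
      simpa using this
    rcases (by simpa using hxm : x = a ∨ x = b) with rfl | rfl
    · exact ⟨b, ⟨hx, hb.1, hab, hb.2.symm⟩, hall⟩
    · exact ⟨a, ⟨hx, ha.1, hab.symm, ha.2.symm⟩, fun y h1 h2 => (hall y h1 h2).symm⟩
  have nc : ∀ {x y}, Tw x y → ¬ C x y := by
    rintro x y ⟨hx, hy, hxy, e⟩ ⟨l, hxl, hyl⟩
    have : ∃ k, inc x k ∧ k ≠ l := by
      have h1 : 1 < #(univ.filter fun l => inc x l) := by rw [ht]; omega
      obtain ⟨k, hk, hkl⟩ := exists_mem_ne h1 l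
      exact ⟨k, by simpa using hk, hkl⟩
    obtain ⟨k, hxk, hkl⟩ := this
    obtain ⟨p, hp, hpk⟩ := ex x hx k hxk
    have h1 : p ∈ O x := ⟨hp, k, hxk, hpk⟩
    rw [e] at h1
    have hpx : x ≠ p := by rintro rfl; exact hx hp
    have := hGQ.tri hxk hpk hpx ⟨l, hyl, hxl⟩ h1.2
    exact hkl (hGQ.1 x y k l hxy hxk this hxl hyl)
  have excl : ∀ {x x' y}, Tw x x' → y ∉ SP → C y x → ¬ C y x' := by
    rintro x x' y hT hy ⟨l, hyl, hxl⟩ h2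
    obtain ⟨p, hp, hpl⟩ := ex y hy l hyl
    have h1 : p ∈ O x := ⟨hp, l, hxl, hpl⟩
    rw [hT.2.2.2] at h1
    have hpy : y ≠ p := by rintro rfl; exact hy hp
    exact nc hT ⟨l, hxl, hGQ.tri hyl hpl hpy (Csymm h2) h1.2⟩
  have triad : ∀ {x x' y}, Tw x x' → ¬ C x y → ¬ C x' y →
      #{z | (C x z ∧ C y z) ∧ z ∈ SP} = q + 1 := by
    intro x x' y hT h1 h2
    have := hGQ.triad hq (by convert hs) (by convert ht) (nc hT) h1 h2
    rw [← this]
    congr 1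
    ext z
    simp only [mem_filter, mem_univ, true_and]
    constructor
    · rintro ⟨⟨h3, h4⟩, h5⟩
      have h6 : z ∈ O x := ⟨h5, h3⟩
      rw [hT.2.2.2] at h6
      exact ⟨⟨h3, h6.2⟩, h4⟩
    · rintro ⟨⟨h3, h4⟩, h5⟩
      refine ⟨⟨h3, h5⟩, ?_⟩
      by_contra hz
      exact excl hT hz (Csymm h3) (Csymm h4)
  have key : ∀ {x x' y y'}, Tw x x' → Tw y y' → x ≠ y → C y x → C y' x' := by
    intro x x' y y' hT hT' hxy h1
    by_contra hcon
    have h2 : ¬ C x y' := excl hT' hT.1 (Csymm h1)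
    have h3 := triad hT h2 (fun h => hcon (Csymm h))
    obtain ⟨l, hyl, hxl⟩ := h1
    have h4 : 1 < #(univ.filter fun z => (C x z ∧ C y' z) ∧ z ∈ SP) := by rw [h3]; omega
    rw [one_lt_card] at h4
    obtain ⟨a, ha, b, hb, hab⟩ := h4
    simp only [mem_filter, mem_univ, true_and] at ha hb
    have onl : ∀ a, ((C x a ∧ C y' a) ∧ a ∈ SP) → inc a l := by
      rintro a ⟨⟨h5, h6⟩, h7⟩
      have h8 : a ∈ O y' := ⟨h7, h6⟩
      rw [← hT'.2.2.2] at h8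
      exact hGQ.tri hxl hyl hxy (Csymm h5) (Csymm h8.2)
    exact hab (un x hT.1 l hxl a ha.2 b hb.2 (onl a ha) (onl b hb))
  let Ros : L → Set (Set P) := fun l => {W | ∃ y, y ∉ SP ∧ inc y l ∧ W = O y}
  have tanl : ∀ {x l}, x ∉ SP → inc x l → Ros l ∈ ELines (L := L) inc SP := by
    intro x l hx hl
    obtain ⟨p, hp, hpl⟩ := ex x hx l hl
    exact ⟨l, ⟨p, ⟨hpl, hp⟩, fun r hr => un x hx l hl r hr.2 p hp hr.1 hpl⟩, rfl⟩
  have rosE : ∀ R ∈ ELines (L := L) inc SP, ∃ l p, p ∈ SP ∧ inc p l ∧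
      (∀ y, inc y l → y ≠ p → y ∉ SP) ∧ R = Ros l := by
    rintro R ⟨l, ⟨p, ⟨hpl, hp⟩, hu⟩, rfl⟩
    exact ⟨l, p, hp, hpl, fun y hy hyp hys => hyp (hu y ⟨hy, hys⟩), rfl⟩
  have mEq : ∀ {x y l}, x ∉ SP → y ∉ SP → inc x l → inc y l → O x = O y → x = y := by
    intro x y l hx hy hxl hyl e
    by_contra hxy
    exact nc ⟨hx, hy, hxy, e⟩ ⟨l, hxl, hyl⟩
  have swapsub : ∀ {x y m l p}, Tw x y → inc x m → inc y l → p ∈ SP → inc p m → inc p l →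
      Ros m ⊆ Ros l := by
    rintro x y m l p hT hxm hyl hp hpm hpl W ⟨z, hz, hzm, rfl⟩
    by_cases hzx : z = x
    · subst hzx; exact ⟨y, hT.2.1, hyl, hT.2.2.2⟩
    · obtain ⟨z', hTz, -⟩ := twin z hz
      have h1 := key hT hTz (Ne.symm hzx) ⟨m, hzm, hxm⟩
      have h2 : p ∈ O z := ⟨hp, m, hzm, hpm⟩
      rw [hTz.2.2.2] at h2
      have hpy : y ≠ p := by rintro rfl; exact hT.2.1 hp
      exact ⟨z', hTz.2.1, hGQ.tri hyl hpl hpy h1 h2.2, hTz.2.2.2⟩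
  have swap : ∀ {x l}, x ∉ SP → O x ∈ Ros l → ∃ m, inc x m ∧ Ros l = Ros m := by
    rintro x l hx ⟨y, hy, hyl, e⟩
    by_cases hxy : x = y
    · subst hxy; exact ⟨l, hyl, rfl⟩
    · have hT : Tw x y := ⟨hx, hy, hxy, e⟩
      obtain ⟨p, hp, hpl⟩ := ex y hy l hyl
      have h2 : p ∈ O y := ⟨hp, l, hyl, hpl⟩
      rw [← e] at h2
      obtain ⟨m, hxm, hpm⟩ := h2.2
      exact ⟨m, hxm, Set.Subset.antisymm (swapsub (Twsymm hT) hyl hxm hp hpl hpm)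
        (swapsub hT hxm hyl hp hpm hpl)⟩
  have uniq : ∀ {x y}, x ∉ SP → O x ≠ O y → ∀ {m m'}, inc x m → inc x m' →
      O y ∈ Ros m → O y ∈ Ros m' → m = m' := by
    rintro x y hx hxy m m' hm hm' ⟨y2, hy2, hym2, e2⟩ ⟨y3, hy3, hym3, e3⟩
    have h23 : y2 = y3 := by
      by_contra hne
      exact excl ⟨hy2, hy3, hne, e2.symm.trans e3⟩ hx ⟨m, hm, hym2⟩ ⟨m', hm', hym3⟩
    subst h23
    have : x ≠ y2 := by rintro rfl; exact hxy e2.symm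
    exact hGQ.1 x y2 m m' this hm hym2 hm' hym3
  have Ecol : ∀ {x x' y}, Tw x x' → y ∉ SP →
      ((∃ R ∈ ELines (L := L) inc SP, O x ∈ R ∧ O y ∈ R) ↔ (C x y ∨ C x' y)) := by
    intro x x' y hT hy
    constructor
    · rintro ⟨R, hR, hxR, hyR⟩
      obtain ⟨l, -, -, -, -, rfl⟩ := rosE R hR
      obtain ⟨m, hym, e⟩ := swap hy hyR
      rw [e] at hxR
      obtain ⟨x1, hx1, hxm, e1⟩ := hxR
      obtain ⟨x'', hT', hall⟩ := twin x hT.1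
      have hx' : x' = x'' := by
        rcases hall x' hT.2.1 hT.2.2.2.symm with h | h
        · exact absurd h.symm hT.2.2.1
        · exact h
      subst hx'
      rcases hall x1 hx1 e1.symm with rfl | rfl
      · exact Or.inl ⟨m, hxm, hym⟩
      · exact Or.inr ⟨m, hxm, hym⟩
    · rintro (⟨l, hxl, hyl⟩ | ⟨l, hxl, hyl⟩)
      · exact ⟨Ros l, tanl hy hyl, ⟨x, hT.1, hxl, rfl⟩, ⟨y, hy, hyl, rfl⟩⟩
      · exact ⟨Ros l, tanl hy hyl, ⟨x', hT.2.1, hxl, hT.2.2.2⟩, ⟨y, hy, hyl, rfl⟩⟩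
  have P2 : ∀ x ∈ EPoints inc SP, ∀ y ∈ EPoints inc SP, x ≠ y →
      ∀ R ∈ ELines (L := L) inc SP, ∀ R' ∈ ELines (L := L) inc SP,
        x ∈ R → y ∈ R → x ∈ R' → y ∈ R' → R = R' := by
    rintro _ ⟨x, hx, rfl⟩ _ ⟨y, hy, rfl⟩ hxy R hR R' hR' h1 h2 h3 h4
    obtain ⟨l, -, -, -, -, rfl⟩ := rosE R hR
    obtain ⟨l', -, -, -, -, rfl⟩ := rosE R' hR'
    obtain ⟨m, hm, e⟩ := swap hx h1
    obtain ⟨m', hm', e'⟩ := swap hx h3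
    rw [e] at h2 ⊢
    rw [e'] at h4 ⊢
    rw [uniq hx hxy hm hm' h2 h4]
  have subE : ∀ l, Ros l ⊆ EPoints inc SP := by
    rintro l W ⟨y, hy, -, rfl⟩
    exact ⟨y, hy, rfl⟩
  refine ⟨?_, P2, ?_, ?_, ?_, ?_⟩
  · rintro _ ⟨x, hx, rfl⟩
    have e : {R | R ∈ ELines (L := L) inc SP ∧ subtend inc SP x ∈ R} = Ros '' {l | inc x l} := by
      ext R
      constructor
      · rintro ⟨hR, hxR⟩
        obtain ⟨l, -, -, -, -, rfl⟩ := rosE R hR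
        obtain ⟨m, hm, e⟩ := swap hx hxR
        exact ⟨m, hm, e.symm⟩
      · rintro ⟨l, hl, rfl⟩
        exact ⟨tanl hx hl, x, hx, hl, rfl⟩
    rw [e, Set.ncard_image_of_injOn, hpoint]
    intro l hl m hm elm
    obtain ⟨p, hp, hpl⟩ := ex x hx l hl
    have h1 : 2 < #(univ.filter fun y => inc y l) := by rw [hs]; omega
    obtain ⟨y, hy, hyn⟩ := exists_mem_notMem_of_card_lt_card
      (lt_of_le_of_lt (card_le_two (a := x) (b := p)) h1)
    simp at hy hyn
    have hyS : y ∉ SP := fun h => hyn.2 (un x hx l hl y h p hp hy hpl)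
    refine uniq (y := y) hx ?_ hl hm ⟨y, hyS, hy, rfl⟩ (elm ▸ ⟨y, hyS, hy, rfl⟩)
    intro e
    exact hyn.1 (mEq hx hyS hl hy e).symm
  · intro R hR
    obtain ⟨l, p, hp, hpl, hext, rfl⟩ := rosE R hR
    refine ⟨subE l, ?_⟩
    have e : Ros l = O '' ({y | inc y l} \ {p}) := by
      ext W
      constructor
      · rintro ⟨y, hy, hyl, rfl⟩
        exact ⟨y, ⟨hyl, fun h => hy ((Set.mem_singleton_iff.1 h) ▸ hp)⟩, rfl⟩
      · rintro ⟨y, ⟨hyl, hyp⟩, rfl⟩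
        exact ⟨y, hext y hyl hyp, hyl, rfl⟩
    rw [e, Set.ncard_image_of_injOn, Set.ncard_sdiff_singleton_of_mem (s := {y | inc y l}) hpl, hline]
    · omega
    · rintro a ⟨ha, hap⟩ b ⟨hb, hbp⟩ eab
      exact mEq (hext a ha hap) (hext b hb hbp) ha hb eab
  · intro R hR R' hR' hne a ha b hb
    by_contra hab
    obtain ⟨l, -, -, -, -, rfl⟩ := rosE R hR
    exact hne (P2 a (subE l ha.1) b (subE l hb.1) hab _ hR _ hR' ha.1 hb.1 ha.2 hb.2)
  · rintro _ ⟨x, hx, rfl⟩ R hR hxR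
    obtain ⟨l, p, hp, hpl, hext, rfl⟩ := rosE R hR
    obtain ⟨x', hT, -⟩ := twin x hx
    have hxl : ¬ inc x l := fun h => hxR ⟨x, hx, h, rfl⟩
    have hxl' : ¬ inc x' l := fun h => hxR ⟨x', hT.2.1, h, hT.2.2.2⟩
    by_cases hxp : C x p
    · left
      have hxp' : C x' p := by
        have : p ∈ O x := ⟨hp, hxp⟩
        rw [hT.2.2.2] at this
        exact this.2
      rw [Set.ncard_eq_zero (Set.toFinite _), Set.eq_empty_iff_forall_notMem]
      rintro W ⟨⟨y, hy, hyl, rfl⟩, hR⟩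
      have hyp : y ≠ p := by rintro rfl; exact hy hp
      rcases (Ecol hT hy).1 hR with h | h
      · exact hxl (hGQ.tri hyl hpl hyp h hxp)
      · exact hxl' (hGQ.tri hyl hpl hyp h hxp')
    · right
      have hxp' : ¬ C x' p := by
        intro h
        have : p ∈ O x' := ⟨hp, h⟩
        rw [← hT.2.2.2] at this
        exact hxp this.2
      obtain ⟨y, ⟨hyl, hxy⟩, hu⟩ := hGQ.2.1 x l hxl
      obtain ⟨y', ⟨hyl', hxy'⟩, hu'⟩ := hGQ.2.1 x' l hxl'
      have hy : y ∉ SP := hext y hyl (by rintro rfl; exact hxp hxy)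
      have hy' : y' ∉ SP := hext y' hyl' (by rintro rfl; exact hxp' hxy')
      have hyy : y ≠ y' := by
        rintro rfl
        exact excl hT hy (Csymm hxy) (Csymm hxy')
      have hOO : O y ≠ O y' := fun e => hyy (mEq hy hy' hyl hyl' e)
      rw [← Set.ncard_pair hOO]
      congr 1
      ext W
      constructor
      · rintro ⟨⟨z, hz, hzl, rfl⟩, hR⟩
        rcases (Ecol hT hz).1 hR with h | h
        · left; rw [hu z ⟨hzl, h⟩]
        · right; rw [hu' z ⟨hzl, h⟩]; rfl
      · rintro (rfl | rfl)
        · exact ⟨⟨y, hy, hyl, rfl⟩, (Ecol hT hy).2 (Or.inl hxy)⟩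
        · exact ⟨⟨y', hy', hyl', rfl⟩, (Ecol hT hy').2 (Or.inr hxy')⟩
  · rintro _ ⟨x, hx, rfl⟩ _ ⟨y, hy, rfl⟩ hxy hno
    obtain ⟨x', hT, hallx⟩ := twin x hx
    obtain ⟨y', hT', -⟩ := twin y hy
    have hno' := fun h => hno ((Ecol hT hy).2 h)
    have hxy1 : ¬ C x y := fun h => hno' (Or.inl h)
    have hxy2 : ¬ C x' y := fun h => hno' (Or.inr h)
    have hno2 := fun h => hno (by
      obtain ⟨R, h1, h2, h3⟩ := (Ecol hT' hx).2 h
      exact ⟨R, h1, h3, h2⟩)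
    have hxy3 : ¬ C x y' := fun h => hno2 (Or.inr (Csymm h))
    have hxy4 : ¬ C x' y' := fun h => by
      refine hxy1 (key (Twsymm hT') (Twsymm hT) ?_ h)
      rintro rfl
      exact hxy (hT.2.2.2.trans hT'.2.2.2.symm)
    have cnt : ∀ w, ¬ C x w → ¬ C x' w → #{z | (C x z ∧ C w z) ∧ z ∉ SP} = q * q - q := by
      intro w h1 h2
      have h3 := triad hT h1 h2
      have h4 : #{z | C x z ∧ C w z} = q * q + 1 := by
        have := hGQ.card_common (by convert ht) h1
        convert this
      have h5 := card_filter_add_card_filter_not (s := univ.filter fun z => C x z ∧ C w z)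
        (fun z => z ∈ SP)
      rw [filter_filter, filter_filter, h3, h4] at h5
      omega
    have e : {z | z ∈ EPoints inc SP ∧
        (∃ R ∈ ELines (L := L) inc SP, z ∈ R ∧ subtend inc SP x ∈ R) ∧
        (∃ R ∈ ELines (L := L) inc SP, z ∈ R ∧ subtend inc SP y ∈ R)} =
        O '' (((univ.filter fun z => (C x z ∧ C y z) ∧ z ∉ SP) ∪
          (univ.filter fun z => (C x z ∧ C y' z) ∧ z ∉ SP) : Finset P) : Set P) := by
      ext W
      constructor
      · rintro ⟨⟨w, hw, rfl⟩, h1, h2⟩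
        obtain ⟨w', hTw, -⟩ := twin w hw
        have : ∃ z, z ∉ SP ∧ C x z ∧ O w = O z := by
          rcases (Ecol hTw hx).1 h1 with h | h
          · exact ⟨w, hw, Csymm h, rfl⟩
          · exact ⟨w', hTw.2.1, Csymm h, hTw.2.2.2⟩
        obtain ⟨z, hz, hxz, e⟩ := this
        refine ⟨z, ?_, e.symm⟩
        change ∃ R ∈ ELines (L := L) inc SP, O w ∈ R ∧ O y ∈ R at h2
        rw [e] at h2
        obtain ⟨R, hR1, hR2, hR3⟩ := h2
        have := (Ecol hT' hz).1 ⟨R, hR1, hR3, hR2⟩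
        simp only [coe_union, coe_filter, mem_univ, true_and, Set.mem_union, Set.mem_ofPred_eq]
        tauto
      · rintro ⟨z, hz, rfl⟩
        simp only [coe_union, coe_filter, mem_univ, true_and, Set.mem_union,
          Set.mem_ofPred_eq] at hz
        have hzS : z ∉ SP := by tauto
        refine ⟨⟨z, hzS, rfl⟩, ?_, ?_⟩
        · obtain ⟨R, h1, h2, h3⟩ := (Ecol hT hzS).2 (by tauto)
          exact ⟨R, h1, h3, h2⟩
        · obtain ⟨R, h1, h2, h3⟩ := (Ecol hT' hzS).2 (by tauto)
          exact ⟨R, h1, h3, h2⟩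
    rw [e, Set.ncard_image_of_injOn, Set.ncard_coe_finset, card_union_of_disjoint,
      cnt y hxy1 hxy2, cnt y' hxy3 hxy4]
    · obtain ⟨k, rfl⟩ : ∃ k, q = k + 1 := ⟨q - 1, by omega⟩
      have : (k + 1) * (k + 1) - (k + 1) = (k + 1) * k := by
        rw [Nat.sub_eq_iff_eq_add (by nlinarith)]; ring
      rw [this]; simp; ring
    · rw [disjoint_left]
      intro z h1 h2
      simp only [mem_filter, mem_univ, true_and] at h1 h2
      exact excl hT' h1.2 (Csymm h1.1.2) (Csymm h2.1.2)
    · intro z hz w hw ezw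
      simp only [coe_union, coe_filter, mem_univ, true_and, Set.mem_union,
          Set.mem_ofPred_eq] at hz hw
      by_contra hne
      have hTzw : Tw z w := ⟨by tauto, by tauto, hne, ezw⟩
      exact excl hTzw hx (by tauto) (by tauto)
end

section
/- Let α be a surjective morphism from a finite thick generalized quadrangle E onto a thick generalized quadrangle E'. Then α is an isomorphism. -/
structure SurjHyp {P L P' L' : Type} (inc : P → L → Prop) (inc' : P' → L' → Prop)
    (fP : P → P') (fL : L → L') : Prop where
  gq : IsGQ inc
  th : Thick inc
  gq' : IsGQ inc'
  th' : Thick inc'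
  mor : ∀ p l, inc p l → inc' (fP p) (fL l)
  sp : Function.Surjective fP
  sl : Function.Surjective fL

theorem IsGQ.tri_s9 {P L : Type} {inc : P → L → Prop} (h : IsGQ inc) {x y z : P} {l n m : L}
    (hx : ¬ inc x l) (hy : inc y l) (hz : inc z l) (h1 : inc x n) (h2 : inc y n)
    (h3 : inc x m) (h4 : inc z m) : y = z :=
  (h.2.1 x l hx).unique ⟨hy, n, h1, h2⟩ ⟨hz, m, h3, h4⟩

theorem IsGQ.proj {P L : Type} {inc : P → L → Prop} (h : IsGQ inc) {x : P} {l : L}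
    (hx : ¬ inc x l) : ∃ y n, inc y l ∧ inc x n ∧ inc y n := by
  obtain ⟨y, ⟨h1, n, h2, h3⟩, -⟩ := h.2.1 x l hx
  exact ⟨y, n, h1, h2, h3⟩

theorem IsGQ.dual {P L : Type} {inc : P → L → Prop} (h : IsGQ inc) :
    IsGQ (fun l p => inc p l) := by
  refine ⟨?_, ?_, h.2.2.2, h.2.2.1⟩
  · intro l m p q hlm h1 h2 h3 h4
    by_contra hpq
    exact hlm (h.1 p q l m hpq h1 h3 h2 h4)
  · intro l x hx
    obtain ⟨y, n, h1, h2, h3⟩ := h.proj hx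
    refine ⟨n, ⟨h2, y, h1, h3⟩, ?_⟩
    rintro m ⟨h4, z, h5, h6⟩
    have := h.tri_s9 hx h1 h5 h2 h3 h4 h6
    subst this
    exact h.1 x y m n (by rintro rfl; exact hx h1) h4 h6 h2 h3

theorem SurjHyp.dual {P L P' L' : Type} {inc : P → L → Prop} {inc' : P' → L' → Prop}
    {fP : P → P'} {fL : L → L'} (H : SurjHyp inc inc' fP fL) :
    SurjHyp (fun l p => inc p l) (fun l p => inc' p l) fL fP :=
  ⟨H.gq.dual, ⟨H.th.2, H.th.1⟩, H.gq'.dual, ⟨H.th'.2, H.th'.1⟩, fun l p => H.mor p l, H.sl, H.sp⟩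

theorem Thick.line_avoid {P L : Type} {inc : P → L → Prop} (h : Thick inc) (p : P) (a b : L) :
    ∃ n, inc p n ∧ n ≠ a ∧ n ≠ b := by
  obtain ⟨l, m, n, h1, h2, h3, h4, h5, h6⟩ := h.1 p
  grind

theorem Thick.pt_avoid {P L : Type} {inc : P → L → Prop} (h : Thick inc) (l : L) (a : P) :
    ∃ n, inc n l ∧ n ≠ a := by
  obtain ⟨l, m, n, h1, h2, h3, h4, h5, h6⟩ := h.2 l
  grind

theorem SurjHyp.loc {P L P' L' : Type} {inc : P → L → Prop} {inc' : P' → L' → Prop}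
    {fP : P → P'} {fL : L → L'} (H : SurjHyp inc inc' fP fL) {l : L} {q : P'}
    (hq : inc' q (fL l)) : ∃ y, inc y l ∧ fP y = q := by
  obtain ⟨m, hm, hml, -⟩ := H.th'.line_avoid q (fL l) (fL l)
  obtain ⟨x', hx', hxq⟩ := H.th'.pt_avoid m q
  obtain ⟨x, rfl⟩ := H.sp x'
  have hxl : ¬ inc' (fP x) (fL l) := fun h => hml (H.gq'.1 _ _ _ _ hxq hx' hm h hq)
  obtain ⟨y, n, h1, h2, h3⟩ := H.gq.proj (fun h => hxl (H.mor _ _ h))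
  exact ⟨y, h1, H.gq'.tri_s9 hxl (H.mor _ _ h1) hq (H.mor _ _ h2) (H.mor _ _ h3) hx' hm⟩

open Classical in
noncomputable def fibCard {P L P' : Type} [Fintype P] (inc : P → L → Prop) (fP : P → P')
    (l : L) (q : P') : ℕ := (Finset.univ.filter (fun x => inc x l ∧ fP x = q)).card

section
variable {P L P' L' : Type} [Fintype P] [Fintype L] {inc : P → L → Prop} {inc' : P' → L' → Prop}
    {fP : P → P'} {fL : L → L'}

theorem SurjHyp.step_le (H : SurjHyp inc inc' fP fL) {l m : L} {q r : P'} {n : L'}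
    (hqr : q ≠ r) (hq : inc' q (fL l)) (hr : inc' r (fL m)) (hqn : inc' q n) (hrn : inc' r n)
    (hl : n ≠ fL l) (hm : n ≠ fL m) : fibCard inc fP l q ≤ fibCard inc fP m r := by
  classical
  have hqm : ¬ inc' q (fL m) := fun h => hm (H.gq'.1 _ _ _ _ hqr hqn hrn h hr)
  have hrl : ¬ inc' r (fL l) := fun h => hl (H.gq'.1 _ _ _ _ hqr hqn hrn hq h)
  unfold fibCard
  apply Finset.card_le_card_of_forall_subsingleton (fun x y => ∃ k, inc x k ∧ inc y k)
  · intro x hx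
    simp only [Finset.mem_filter, Finset.mem_univ, true_and] at hx ⊢
    obtain ⟨hx, rfl⟩ := hx
    obtain ⟨y, k, h1, h2, h3⟩ := H.gq.proj (fun h => hqm (H.mor _ _ h))
    exact ⟨y, ⟨h1, H.gq'.tri_s9 hqm (H.mor _ _ h1) hr (H.mor _ _ h2) (H.mor _ _ h3) hqn hrn⟩,
      k, h2, h3⟩
  · intro y hy
    simp only [Finset.mem_filter, Finset.mem_univ, true_and] at hy
    obtain ⟨hy, rfl⟩ := hy
    rintro x1 ⟨h1, k1, h2, h3⟩ x2 ⟨h4, k2, h5, h6⟩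
    simp only [Finset.mem_filter, Finset.mem_univ, true_and] at h1 h4
    exact H.gq.tri_s9 (fun h => hrl (H.mor _ _ h)) h1.1 h4.1 h3 h2 h6 h5

theorem SurjHyp.step (H : SurjHyp inc inc' fP fL) {l m : L} {q r : P'} {n : L'}
    (hqr : q ≠ r) (hq : inc' q (fL l)) (hr : inc' r (fL m)) (hqn : inc' q n) (hrn : inc' r n)
    (hl : n ≠ fL l) (hm : n ≠ fL m) : fibCard inc fP l q = fibCard inc fP m r :=
  le_antisymm (H.step_le hqr hq hr hqn hrn hl hm) (H.step_le hqr.symm hr hq hrn hqn hm hl)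

theorem SurjHyp.same (H : SurjHyp inc inc' fP fL) {l m : L} {q : P'}
    (hq : inc' q (fL l)) (hr : inc' q (fL m)) : fibCard inc fP l q = fibCard inc fP m q := by
  obtain ⟨n, hn, h1, h2⟩ := H.th'.line_avoid q (fL l) (fL m)
  obtain ⟨r, hrn, hrq⟩ := H.th'.pt_avoid n q
  obtain ⟨k', hk, hkn, -⟩ := H.th'.line_avoid r n n
  obtain ⟨k, rfl⟩ := H.sl k'
  rw [H.step hrq.symm hq hk hn hrn h1 hkn.symm, H.step hrq.symm hr hk hn hrn h2 hkn.symm]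

theorem SurjHyp.col (H : SurjHyp inc inc' fP fL) {l m : L} {q r : P'} {n : L'}
    (hq : inc' q (fL l)) (hr : inc' r (fL m)) (hqn : inc' q n) (hrn : inc' r n) :
    fibCard inc fP l q = fibCard inc fP m r := by
  by_cases hqr : q = r
  · subst hqr; exact H.same hq hr
  obtain ⟨l2, h1, h2, -⟩ := H.th'.line_avoid q n n
  obtain ⟨m2, h3, h4, -⟩ := H.th'.line_avoid r n n
  obtain ⟨l2, rfl⟩ := H.sl l2
  obtain ⟨m2, rfl⟩ := H.sl m2
  rw [H.same hq h1, H.same hr h3, H.step hqr h1 h3 hqn hrn h2.symm h4.symm]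

theorem SurjHyp.const (H : SurjHyp inc inc' fP fL) {l m : L} {q r : P'}
    (hq : inc' q (fL l)) (hr : inc' r (fL m)) : fibCard inc fP l q = fibCard inc fP m r := by
  by_cases h : inc' q (fL m)
  · exact H.col hq hr h hr
  obtain ⟨y, n, h1, h2, h3⟩ := H.gq'.proj h
  rw [H.col hq h1 h2 h3, H.col h1 hr h1 hr]

theorem SurjHyp.fib_pos (H : SurjHyp inc inc' fP fL) {l : L} {q : P'}
    (hq : inc' q (fL l)) : 0 < fibCard inc fP l q := by
  classical
  obtain ⟨y, h1, h2⟩ := H.loc hq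
  exact Finset.card_pos.2 ⟨y, by simp [h1, h2]⟩

open Classical in
theorem SurjHyp.three (H : SurjHyp inc inc' fP fL) {c : ℕ}
    (hc : ∀ l q, inc' q (fL l) → fibCard inc fP l q = c) (l : L) :
    3 * c ≤ (Finset.univ.filter (fun x => inc x l)).card := by
  obtain ⟨p, q, r, h1, h2, h3, h4, h5, h6⟩ := H.th'.2 (fL l)
  have e : 3 * c = fibCard inc fP l p + fibCard inc fP l q + fibCard inc fP l r := by
    rw [hc _ _ h4, hc _ _ h5, hc _ _ h6]; ring
  rw [e]; unfold fibCard
  rw [← Finset.card_union_of_disjoint, ← Finset.card_union_of_disjoint]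
  · apply Finset.card_le_card
    intro x; simp; tauto
  · rw [Finset.disjoint_left]; intro x; simp; grind
  · rw [Finset.disjoint_left]; intro x; simp; grind

open Classical in
/-- double count -/
theorem dcount (l : L) (x' : P') :
    ∑ y with inc y l, ∑ n with inc y n, fibCard inc fP n x' =
    ∑ z with fP z = x', ∑ y with inc y l, (Finset.univ.filter (fun n => inc y n ∧ inc z n)).card := by
  simp only [fibCard, Finset.card_filter]
  rw [Finset.sum_comm]
  refine Finset.sum_congr rfl fun y _ => ?_
  rw [Finset.sum_comm' (t' := Finset.univ) (s' := fun _ => Finset.univ.filter (fun n => inc y n))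
    (by simp), Finset.sum_filter]
  refine Finset.sum_congr rfl fun z _ => ?_
  rw [Finset.sum_filter]
  split_ifs with h
  · refine Finset.sum_congr rfl fun n _ => ?_
    by_cases h1 : inc y n <;> simp [h1, h]
  · simp [h]

open Classical in
theorem inner_off (H : IsGQ inc) {l : L} {z : P} (hz : ¬ inc z l) :
    ∑ y with inc y l, (Finset.univ.filter (fun n => inc y n ∧ inc z n)).card = 1 := by
  obtain ⟨y, n, h1, h2, h3⟩ := H.proj hz
  rw [Finset.sum_eq_single y]
  · rw [Finset.card_eq_one]
    refine ⟨n, ?_⟩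
    ext m
    simp only [Finset.mem_filter, Finset.mem_univ, true_and, Finset.mem_singleton]
    refine ⟨fun h => H.1 y z m n (by rintro rfl; exact hz h1) h.1 h.2 h3 h2, ?_⟩
    rintro rfl; exact ⟨h3, h2⟩
  · intro w hw hwy
    simp only [Finset.mem_filter, Finset.mem_univ, true_and] at hw
    rw [Finset.card_eq_zero, Finset.filter_eq_empty_iff]
    rintro k - ⟨h4, h5⟩
    exact hwy (H.tri_s9 hz hw h1 h5 h4 h2 h3)
  · intro h; simp [h1] at h

open Classical in
theorem inner_on (H : IsGQ inc) {l : L} {z : P} (hz : inc z l) :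
    (∑ y with inc y l, (Finset.univ.filter (fun n => inc y n ∧ inc z n)).card) + 1 =
    (Finset.univ.filter (fun n => inc z n)).card + (Finset.univ.filter (fun y => inc y l)).card := by
  have hm : z ∈ Finset.univ.filter (fun y => inc y l) := by simp [hz]
  rw [← Finset.add_sum_erase _ _ hm, ← Finset.card_erase_add_one hm]
  have : ∀ y ∈ (Finset.univ.filter (fun y => inc y l)).erase z,
      (Finset.univ.filter (fun n => inc y n ∧ inc z n)).card = 1 := by
    intro y hy
    simp only [Finset.mem_erase, Finset.mem_filter, Finset.mem_univ, true_and] at hy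
    rw [Finset.card_eq_one]
    refine ⟨l, ?_⟩
    ext m
    simp only [Finset.mem_filter, Finset.mem_univ, true_and, Finset.mem_singleton]
    refine ⟨fun h => H.1 y z m l hy.1 h.1 h.2 hy.2 hz, ?_⟩
    rintro rfl; exact ⟨hy.2, hz⟩
  rw [Finset.sum_congr rfl this]
  simp
  ring

open Classical in
theorem SurjHyp.W_same (H : SurjHyp inc inc' fP fL) {c : ℕ}
    (hc : ∀ l q, inc' q (fL l) → fibCard inc fP l q = c) (y : P) :
    ∑ n with inc y n, fibCard inc fP n (fP y) =
      c * (Finset.univ.filter (fun n => inc y n)).card := by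
  rw [Finset.sum_congr rfl (g := fun _ => c)]
  · simp [mul_comm]
  · intro n hn
    simp only [Finset.mem_filter, Finset.mem_univ, true_and] at hn
    exact hc _ _ (H.mor _ _ hn)

theorem SurjHyp.fib_zero (H : SurjHyp inc inc' fP fL) {l : L} {q : P'}
    (hq : ¬ inc' q (fL l)) : fibCard inc fP l q = 0 := by
  classical
  unfold fibCard
  rw [Finset.card_eq_zero, Finset.filter_eq_empty_iff]
  rintro x - ⟨h, rfl⟩
  exact hq (H.mor _ _ h)

open Classical in
theorem SurjHyp.W_col (H : SurjHyp inc inc' fP fL) {c d : ℕ}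
    (hc : ∀ l q, inc' q (fL l) → fibCard inc fP l q = c)
    (hd : ∀ p m, inc' (fP p) m → fibCard (fun l p => inc p l) fL p m = d) {y : P} {x' : P'} {n' : L'}
    (hne : fP y ≠ x') (h1 : inc' (fP y) n') (h2 : inc' x' n') :
    ∑ n with inc y n, fibCard inc fP n x' = d * c := by
  have : ∀ n ∈ Finset.univ.filter (fun n => inc y n), fibCard inc fP n x' =
      if fL n = n' then c else 0 := by
    intro n hn
    simp only [Finset.mem_filter, Finset.mem_univ, true_and] at hn
    split_ifs with h
    · exact hc _ _ (h ▸ h2)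
    · exact H.fib_zero fun h3 => h (H.gq'.1 _ _ _ _ hne (H.mor _ _ hn) h3 h1 h2)
  rw [Finset.sum_congr rfl this, ← hd y n' h1, fibCard, ← Finset.sum_filter, Finset.filter_filter]
  simp

open Classical in
theorem SurjHyp.W_far (H : SurjHyp inc inc' fP fL) {y : P} {x' : P'}
    (hne : ∀ n', inc' (fP y) n' → ¬ inc' x' n') :
    ∑ n with inc y n, fibCard inc fP n x' = 0 := by
  refine Finset.sum_eq_zero fun n hn => ?_
  simp only [Finset.mem_filter, Finset.mem_univ, true_and] at hn
  exact H.fib_zero (hne _ (H.mor _ _ hn))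

open Classical in
/-- size of a point fibre -/
theorem SurjHyp.fibre (H : SurjHyp inc inc' fP fL) {c d : ℕ}
    (hc : ∀ l q, inc' q (fL l) → fibCard inc fP l q = c)
    (hd : ∀ p m, inc' (fP p) m → fibCard (fun l p => inc p l) fL p m = d) (x' : P') :
    (Finset.univ.filter (fun z => fP z = x')).card = c * (d * c) := by
  obtain ⟨n', hn⟩ := H.gq'.2.2.1 x'
  obtain ⟨q', hq, hqx⟩ := H.th'.pt_avoid n' x'
  obtain ⟨l', hl, hln, -⟩ := H.th'.line_avoid q' n' n'
  obtain ⟨l, rfl⟩ := H.sl l'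
  have hxl : ¬ inc' x' (fL l) := fun h => hln (H.gq'.1 _ _ _ _ hqx hl h hq hn)
  have key := dcount (inc := inc) (fP := fP) l x'
  have hR : ∀ z ∈ Finset.univ.filter (fun z => fP z = x'),
      ∑ y with inc y l, (Finset.univ.filter (fun n => inc y n ∧ inc z n)).card = 1 := by
    intro z hz
    simp only [Finset.mem_filter, Finset.mem_univ, true_and] at hz
    subst hz
    exact inner_off H.gq fun h => hxl (H.mor _ _ h)
  have hL : ∀ y ∈ Finset.univ.filter (fun y => inc y l),
      ∑ n with inc y n, fibCard inc fP n x' = if fP y = q' then d * c else 0 := by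
    intro y hy
    simp only [Finset.mem_filter, Finset.mem_univ, true_and] at hy
    split_ifs with h
    · subst h
      exact H.W_col hc hd hqx hq hn
    · refine H.W_far fun k h1 h2 => h ?_
      exact H.gq'.tri_s9 hxl (H.mor _ _ hy) hl h2 h1 hn hq
  rw [Finset.sum_congr rfl hR, Finset.sum_congr rfl hL, ← Finset.sum_filter,
    Finset.filter_filter] at key
  simp only [Finset.sum_const, smul_eq_mul, mul_one] at key
  rw [← key, ← hc l q' hl, fibCard]

open Classical in
theorem SurjHyp.second (H : SurjHyp inc inc' fP fL) {c d : ℕ}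
    (hc : ∀ l q, inc' q (fL l) → fibCard inc fP l q = c)
    (hd : ∀ p m, inc' (fP p) m → fibCard (fun l p => inc p l) fL p m = d) {l : L} {x' : P'}
    (hx : inc' x' (fL l)) :
    ∃ U S : ℕ, 3 * d * c ≤ U ∧ 3 * c ≤ S ∧ c * U + S * (d * c) + 2 * c =
      c * (d * c) + c * (d * c) + U + c * S := by
  set A := Finset.univ.filter (fun y => inc y l ∧ fP y = x') with hA
  have hAc : A.card = c := hc l x' hx
  set T : P → ℕ := fun z => (Finset.univ.filter (fun n => inc z n)).card with hT
  set S := (Finset.univ.filter (fun y => inc y l)).card with hS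
  refine ⟨∑ z ∈ A, T z, S, ?_, H.three hc l, ?_⟩
  · have : ∑ z ∈ A, 3 * d ≤ ∑ z ∈ A, T z :=
      Finset.sum_le_sum fun z _ => H.dual.three (fun p m h => hd p m h) z
    simp only [Finset.sum_const, smul_eq_mul, hAc] at this
    linarith
  have key := dcount (inc := inc) (fP := fP) l x'
  rw [← Finset.sum_filter_add_sum_filter_not _ (fun y => fP y = x'), Finset.filter_filter,
    Finset.filter_filter] at key
  have hL1 : ∀ y ∈ A, ∑ n with inc y n, fibCard inc fP n x' = c * T y := by
    intro y hy
    simp only [hA, Finset.mem_filter, Finset.mem_univ, true_and] at hy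
    obtain ⟨hy, rfl⟩ := hy
    exact H.W_same hc y
  have hL2 : ∀ y ∈ Finset.univ.filter (fun y => inc y l ∧ ¬ fP y = x'),
      ∑ n with inc y n, fibCard inc fP n x' = d * c := by
    intro y hy
    simp only [Finset.mem_filter, Finset.mem_univ, true_and] at hy
    exact H.W_col hc hd hy.2 (H.mor _ _ hy.1) hx
  have hB : (Finset.univ.filter (fun y => inc y l ∧ ¬ fP y = x')).card + c = S := by
    rw [hS, ← Finset.card_filter_add_card_filter_not (s := Finset.univ.filter (fun y => inc y l))
      (fun y => fP y = x'), Finset.filter_filter, Finset.filter_filter, ← hAc, add_comm]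
  have hN := H.fibre hc hd x'
  rw [← Finset.sum_filter_add_sum_filter_not (Finset.univ.filter (fun z => fP z = x'))
    (fun z => inc z l), Finset.filter_filter, Finset.filter_filter] at key
  rw [← Finset.card_filter_add_card_filter_not (s := Finset.univ.filter (fun z => fP z = x'))
      (fun z => inc z l), Finset.filter_filter, Finset.filter_filter] at hN
  have hA' : Finset.univ.filter (fun z => fP z = x' ∧ inc z l) = A := by
    ext z; simp [hA, and_comm]
  rw [hA'] at key hN
  have hR1 : (∑ z ∈ A, ∑ y with inc y l,
      (Finset.univ.filter (fun n => inc y n ∧ inc z n)).card) + c = (∑ z ∈ A, T z) + c * S := by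
    have : ∑ z ∈ A, ((∑ y with inc y l,
      (Finset.univ.filter (fun n => inc y n ∧ inc z n)).card) + 1) = ∑ z ∈ A, (T z + S) := by
      refine Finset.sum_congr rfl fun z hz => ?_
      simp only [hA, Finset.mem_filter, Finset.mem_univ, true_and] at hz
      exact inner_on H.gq hz.1
    rw [Finset.sum_add_distrib, Finset.sum_add_distrib] at this
    simpa [hAc] using this
  have hR2 : ∀ z ∈ Finset.univ.filter (fun z => fP z = x' ∧ ¬ inc z l),
      ∑ y with inc y l, (Finset.univ.filter (fun n => inc y n ∧ inc z n)).card = 1 := by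
    intro z hz
    simp only [Finset.mem_filter, Finset.mem_univ, true_and] at hz
    exact inner_off H.gq hz.2
  rw [Finset.sum_congr rfl hR2, Finset.sum_congr rfl hL1, Finset.sum_congr rfl hL2,
    ← Finset.mul_sum] at key
  simp only [Finset.sum_const, smul_eq_mul, mul_one] at key
  rw [hAc] at hN
  rw [← hB] at hR1 ⊢
  nlinarith

theorem arith {c d U S : ℕ} (hc : 0 < c) (hd : 0 < d) (hU : 3 * d * c ≤ U) (hS : 3 * c ≤ S)
    (h : c * U + S * (d * c) + 2 * c = c * (d * c) + c * (d * c) + U + c * S) :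
    c = 1 ∧ d = 1 := by
  obtain ⟨a, rfl⟩ := Nat.exists_eq_add_of_le' hc
  obtain ⟨b, rfl⟩ := Nat.exists_eq_add_of_le' hd
  obtain ⟨u, rfl⟩ := Nat.exists_eq_add_of_le hU
  obtain ⟨s, rfl⟩ := Nat.exists_eq_add_of_le hS
  have : (a + 1) * (a + b + 4 * a * b) ≤ 0 := by
    zify at h ⊢
    have h1 : (0 : ℤ) ≤ a * u := by positivity
    have h2 : (0 : ℤ) ≤ s * b * (a + 1) := by positivity
    nlinarith
  have h3 : a + b + 4 * a * b = 0 := by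
    rcases Nat.mul_eq_zero.1 (Nat.le_zero.1 this) with h | h
    · omega
    · exact h
  omega

theorem SurjHyp.inj (H : SurjHyp inc inc' fP fL) : Function.Injective fP := by
  classical
  intro x y hxy
  obtain ⟨l, hl⟩ := H.gq.2.2.1 x
  have hl' := H.mor _ _ hl
  obtain ⟨c, hc0⟩ : ∃ c, fibCard inc fP l (fP x) = c := ⟨_, rfl⟩
  obtain ⟨d, hd0⟩ : ∃ d, fibCard (fun l p => inc p l) fL x (fL l) = d := ⟨_, rfl⟩
  have hc : ∀ m q, inc' q (fL m) → fibCard inc fP m q = c := fun m q h => by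
    rw [← hc0]; exact H.const h hl'
  have hd : ∀ p m, inc' (fP p) m → fibCard (fun l p => inc p l) fL p m = d := fun p m h => by
    rw [← hd0]; exact H.dual.const h hl'
  obtain ⟨U, S, hU, hS, h⟩ := H.second hc hd hl'
  obtain ⟨rfl, rfl⟩ := arith (hc0 ▸ H.fib_pos hl') (hd0 ▸ H.dual.fib_pos hl') hU hS h
  have hN := H.fibre hc hd (fP x)
  exact Finset.card_le_one.1 hN.le x (by simp) y (by simp [hxy])
end

/-- Hughes–Pasini, finite case: a surjective morphism from a
finite thick generalized quadrangle onto a thick generalized quadrangle is an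
isomorphism. -/
theorem surjective_morphism_thick_GQ_is_iso
    {P L P' L' : Type} [Fintype P] [Fintype L]
    (inc : P → L → Prop) (inc' : P' → L' → Prop)
    (hGQ : IsGQ inc) (hthick : Thick inc)
    (hGQ' : IsGQ inc') (hthick' : Thick inc')
    (fP : P → P') (fL : L → L')
    (hmor : ∀ p l, inc p l → inc' (fP p) (fL l))
    (hsurjP : Function.Surjective fP) (hsurjL : Function.Surjective fL) :
    Function.Bijective fP ∧ Function.Bijective fL ∧
      ∀ p l, inc p l ↔ inc' (fP p) (fL l) := by
  have H : SurjHyp inc inc' fP fL := ⟨hGQ, hthick, hGQ', hthick', hmor, hsurjP, hsurjL⟩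
  refine ⟨⟨H.inj, hsurjP⟩, ⟨H.dual.inj, hsurjL⟩, fun p l => ⟨hmor p l, fun h => ?_⟩⟩
  obtain ⟨y, hy, hyp⟩ := H.loc h
  exact H.inj hyp ▸ hy
end

section
/- Let q be an odd prime power and Y a full grid of order (q,1) in Q(4,q) (a subquadrangle of order (q,1) containing all points of its lines). Then the elementwise stabilizer of Y in Aut(Q(4,q)) has order 2. -/
/-- The parabolic quadratic form `x₀² + x₁x₂ + x₃x₄` on `K⁵` defining the
classical generalized quadrangle `Q(4,q)`. -/
def parabolicForm (K : Type) [Field K] (v : Fin 5 → K) : K :=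
  v 0 * v 0 + v 1 * v 2 + v 3 * v 4

/-- The points of `Q(4,q)`: the projective points of `PG(4,q)` on the
parabolic quadric. -/
def QPoints (K : Type) [Field K] : Type :=
  {x : Projectivization K (Fin 5 → K) // parabolicForm K x.rep = 0}

/-- The lines of `Q(4,q)`: the totally singular projective lines
(2-dimensional subspaces on which the form vanishes identically). -/
def QLines (K : Type) [Field K] : Type :=
  {W : Submodule K (Fin 5 → K) //
    Module.finrank K W = 2 ∧ ∀ v ∈ W, parabolicForm K v = 0}

/-- Incidence in `Q(4,q)`: a point lies on a line when its associated
1-dimensional subspace is contained in the corresponding plane. -/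
def QInc (K : Type) [Field K] : QPoints K → QLines K → Prop :=
  fun x W => Projectivization.submodule x.1 ≤ W.1

section helpers

variable {K : Type} [Field K]

/-- polar form -/
def polB (v w : Fin 5 → K) : K :=
  2 * (v 0 * w 0) + v 1 * w 2 + v 2 * w 1 + v 3 * w 4 + v 4 * w 3

lemma pf_add (v w : Fin 5 → K) :
    parabolicForm K (v + w) = parabolicForm K v + parabolicForm K w + polB v w := by
  simp [parabolicForm, polB]; ring

lemma pf_smul (a : K) (v : Fin 5 → K) :
    parabolicForm K (a • v) = a ^ 2 * parabolicForm K v := by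
  simp [parabolicForm]; ring

lemma polB_add_left (u v w : Fin 5 → K) : polB (u + v) w = polB u w + polB v w := by
  simp [polB]; ring

lemma polB_add_right (u v w : Fin 5 → K) : polB w (u + v) = polB w u + polB w v := by
  simp [polB]; ring

lemma polB_smul_left (a : K) (v w : Fin 5 → K) : polB (a • v) w = a * polB v w := by
  simp [polB]; ring

lemma polB_smul_right (a : K) (v w : Fin 5 → K) : polB v (a • w) = a * polB v w := by
  simp [polB]; ring

lemma polB_comm (v w : Fin 5 → K) : polB v w = polB w v := by
  simp [polB]; ring

lemma polB_self (v : Fin 5 → K) : polB v v = 2 * parabolicForm K v := by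
  simp [polB, parabolicForm]; ring

/-- a chosen vector of a point -/
noncomputable def vec (x : QPoints K) : Fin 5 → K := x.1.rep

lemma vec_ne (x : QPoints K) : vec x ≠ 0 := x.1.rep_nonzero

lemma vec_pf (x : QPoints K) : parabolicForm K (vec x) = 0 := x.2

lemma exists_pt (v : Fin 5 → K) (hv : v ≠ 0) (hQ : parabolicForm K v = 0) :
    ∃ x : QPoints K, ∃ a : K, a ≠ 0 ∧ vec x = a • v := by
  obtain ⟨a, ha⟩ := Projectivization.exists_smul_eq_mk_rep K v hv
  have ha' : (a : K) • v = (Projectivization.mk K v hv).rep := ha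
  refine ⟨⟨Projectivization.mk K v hv, ?_⟩, a, a.ne_zero, ?_⟩
  · rw [← ha', pf_smul, hQ, mul_zero]
  · exact ha'.symm

lemma pt_ext {x y : QPoints K} (a : K) (h : vec x = a • vec y) : x = y := by
  apply Subtype.ext
  have ha : a ≠ 0 := by
    rintro rfl
    exact vec_ne x (by simpa using h)
  rw [← Projectivization.mk_rep x.1, ← Projectivization.mk_rep y.1,
    Projectivization.mk_eq_mk_iff]
  exact ⟨Units.mk0 a ha, h.symm⟩

lemma qinc_iff (x : QPoints K) (W : QLines K) : QInc K x W ↔ vec x ∈ W.1 := by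
  unfold QInc vec
  rw [Projectivization.submodule_eq, Submodule.span_singleton_le_iff_mem]

lemma qinc_of_smul {x : QPoints K} {a : K} {v : Fin 5 → K} (W : QLines K) (ha : a ≠ 0)
    (h : vec x = a • v) : QInc K x W ↔ v ∈ W.1 := by
  rw [qinc_iff, h, Submodule.smul_mem_iff _ ha]

lemma line_polB (W : QLines K) {v w : Fin 5 → K} (hv : v ∈ W.1) (hw : w ∈ W.1) :
    polB v w = 0 := by
  have := pf_add v w
  rw [W.2.2 _ hv, W.2.2 _ hw, W.2.2 _ (W.1.add_mem hv hw)] at this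
  simpa using this.symm

lemma line_ext {l m : QLines K} (h : ∀ x, QInc K x l → QInc K x m)
    (h' : ∀ x, QInc K x m → QInc K x l) : l = m := by
  have key : ∀ l m : QLines K, (∀ x, QInc K x l → QInc K x m) → l.1 ≤ m.1 := by
    intro l m h v hv
    by_cases h0 : v = 0
    · rw [h0]; exact m.1.zero_mem
    obtain ⟨x, a, ha, hx⟩ := exists_pt v h0 (l.2.2 v hv)
    exact (qinc_of_smul m ha hx).1 (h x ((qinc_of_smul l ha hx).2 hv))
  exact Subtype.ext (le_antisymm (key l m h) (key m l h'))

lemma indep_pair {x y : QPoints K} (h : x ≠ y) : LinearIndependent K ![vec x, vec y] := by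
  rw [LinearIndependent.pair_iff]
  intro s t hst
  by_cases hs : s = 0
  · subst hs
    simp [vec_ne] at hst
    exact ⟨rfl, hst⟩
  · exfalso
    apply h
    apply pt_ext (-s⁻¹ * t)
    have : s • vec x = -(t • vec y) := eq_neg_of_add_eq_zero_left hst
    calc vec x = s⁻¹ • (s • vec x) := by rw [smul_smul, inv_mul_cancel₀ hs, one_smul]
      _ = _ := by rw [this, smul_neg, smul_smul, neg_mul, neg_smul]

/-- the vectors of a line are combinations of two distinct points -/
lemma line_span {x y : QPoints K} (h : x ≠ y) (W : QLines K) (hx : QInc K x W)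
    (hy : QInc K y W) : W.1 = Submodule.span K {vec x, vec y} := by
  rw [qinc_iff] at hx hy
  symm
  have hle : Submodule.span K {vec x, vec y} ≤ W.1 := by
    rw [Submodule.span_le]
    rintro v (rfl | rfl)
    · exact hx
    · exact hy
  apply Submodule.eq_of_le_of_finrank_le hle
  have := finrank_span_eq_card (indep_pair h)
  rw [Matrix.range_cons, Matrix.range_cons, Matrix.range_empty, Set.union_empty] at this
  exact (W.2.1.trans this.symm).le

lemma collin_polB {x y : QPoints K} (h : Collin (QInc K) x y) : polB (vec x) (vec y) = 0 := by
  obtain ⟨M, h1, h2⟩ := h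
  exact line_polB M ((qinc_iff _ _).1 h1) ((qinc_iff _ _).1 h2)

lemma polB_collin {x y : QPoints K} (hne : x ≠ y) (h : polB (vec x) (vec y) = 0) :
    Collin (QInc K) x y := by
  have hf : Module.finrank K (Submodule.span K {vec x, vec y}) = 2 := by
    have hf := finrank_span_eq_card (indep_pair hne)
    rw [Matrix.range_cons, Matrix.range_cons, Matrix.range_empty, Set.union_empty] at hf
    exact hf
  refine ⟨⟨Submodule.span K {vec x, vec y}, hf, ?_⟩, ?_, ?_⟩
  · intro v hv
    obtain ⟨s, t, rfl⟩ := Submodule.mem_span_pair.1 hv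
    rw [pf_add, pf_smul, pf_smul, polB_smul_left, polB_smul_right, h, vec_pf, vec_pf]
    ring
  · exact (qinc_iff _ _).2 (Submodule.subset_span (by simp))
  · exact (qinc_iff _ _).2 (Submodule.subset_span (by simp))

/-- an automorphism -/
def IsAut (g : Equiv.Perm (QPoints K) × Equiv.Perm (QLines K)) : Prop :=
  ∀ x l, QInc K x l ↔ QInc K (g.1 x) (g.2 l)

lemma aut_polB {g : Equiv.Perm (QPoints K) × Equiv.Perm (QLines K)} (hg : IsAut g)
    {x y : QPoints K} (h : polB (vec x) (vec y) = 0) :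
    polB (vec (g.1 x)) (vec (g.1 y)) = 0 := by
  by_cases hxy : x = y
  · subst hxy
    rw [polB_self, vec_pf, mul_zero]
  · obtain ⟨M, h1, h2⟩ := polB_collin hxy h
    exact collin_polB ⟨g.2 M, (hg _ _).1 h1, (hg _ _).1 h2⟩

lemma aut_ext {g g' : Equiv.Perm (QPoints K) × Equiv.Perm (QLines K)} (hg : IsAut g)
    (hg' : IsAut g') (h : ∀ x, g.1 x = g'.1 x) : g = g' := by
  have h1 : g.1 = g'.1 := Equiv.ext h
  refine Prod.ext h1 (Equiv.ext fun l => ?_)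
  have key : ∀ x, QInc K x (g.2 l) ↔ QInc K x (g'.2 l) := by
    intro x
    have e1 := hg (g.1.symm x) l
    have e2 := hg' (g.1.symm x) l
    rw [← h] at e2
    simp only [Equiv.apply_symm_apply] at e1 e2
    exact e1.symm.trans e2
  exact line_ext (fun x => (key x).1) (fun x => (key x).2)

/-- an involutive isometry induces an automorphism -/
lemma exists_aut (R : (Fin 5 → K) ≃ₗ[K] (Fin 5 → K)) (hR : ∀ v, R (R v) = v)
    (hQ : ∀ v, parabolicForm K (R v) = parabolicForm K v) :
    ∃ r : Equiv.Perm (QPoints K) × Equiv.Perm (QLines K), IsAut r ∧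
      (∀ x, r.1 (r.1 x) = x) ∧ (∀ l, r.2 (r.2 l) = l) ∧
      ∀ x, ∃ a : K, a ≠ 0 ∧ vec (r.1 x) = a • R (vec x) := by
  have h1 : ∀ x : QPoints K, ∃ y : QPoints K, ∃ a : K, a ≠ 0 ∧ vec y = a • R (vec x) :=
    fun x => exists_pt (R (vec x)) (by simpa using vec_ne x) (by rw [hQ, vec_pf])
  choose f a ha hf using h1
  have hff : Function.Involutive f := by
    intro x
    apply pt_ext (a (f x) * a x)
    rw [hf, hf, map_smul, hR, smul_smul]
  let F : QLines K → QLines K := fun W => ⟨W.1.map R.toLinearMap, by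
    refine ⟨?_, ?_⟩
    · exact (LinearEquiv.finrank_map_eq R W.1).trans W.2.1
    · rintro _ ⟨v, hv, rfl⟩
      exact (hQ v).trans (W.2.2 v hv)⟩
  have hmem : ∀ W v, v ∈ (F W).1 ↔ R v ∈ W.1 := by
    intro W v
    constructor
    · rintro ⟨w, hw, rfl⟩
      have : R (R w) ∈ W.1 := by rw [hR]; exact hw
      exact this
    · intro h
      exact ⟨R v, h, hR v⟩
  have hFF : Function.Involutive F := by
    intro W
    apply Subtype.ext
    ext v
    rw [hmem, hmem, hR]
  refine ⟨(hff.toPerm, hFF.toPerm), ?_, hff, hFF, fun x => ⟨a x, ha x, hf x⟩⟩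
  intro x l
  change QInc K x l ↔ QInc K (f x) (F l)
  rw [qinc_of_smul (F l) (ha x) (hf x), hmem, hR, qinc_iff]

theorem stage2 (h2 : (2 : K) ≠ 0) (ν : K) (hν : ν ≠ 0)
    (e : (Fin 5 → K) ≃ₗ[K] (Fin 5 → K))
    (he : ∀ v, parabolicForm K (e v) = ν * (v 0 * v 0) + v 1 * v 2 + v 3 * v 4)
    (YP : Set (QPoints K)) (YL : Set (QLines K))
    (hfull : IsFull (QInc K) YP YL)
    (hY : ∀ x, x ∈ YP ↔ e.symm (vec x) 0 = 0) :
    Nat.card {g : Equiv.Perm (QPoints K) × Equiv.Perm (QLines K) //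
      (∀ x l, QInc K x l ↔ QInc K (g.1 x) (g.2 l)) ∧
      (∀ x ∈ YP, g.1 x = x) ∧ (∀ l ∈ YL, g.2 l = l)} = 2 := by
  have hB : ∀ v w, polB v w = 2 * ν * (e.symm v 0 * e.symm w 0) +
      e.symm v 1 * e.symm w 2 + e.symm v 2 * e.symm w 1 +
      e.symm v 3 * e.symm w 4 + e.symm v 4 * e.symm w 3 := by
    intro v w
    have h := pf_add v w
    have h1 := he (e.symm v)
    have h2 := he (e.symm w)
    have h3 := he (e.symm (v + w))
    simp only [LinearEquiv.apply_symm_apply, map_add, Pi.add_apply] at h1 h2 h3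
    linear_combination h3 - h - h1 - h2
  have hQ : ∀ x : QPoints K, ν * (e.symm (vec x) 0 * e.symm (vec x) 0) +
      e.symm (vec x) 1 * e.symm (vec x) 2 + e.symm (vec x) 3 * e.symm (vec x) 4 = 0 := by
    intro x
    have := he (e.symm (vec x))
    rw [LinearEquiv.apply_symm_apply, vec_pf] at this
    exact this.symm
  -- the reflection
  let s : (Fin 5 → K) →ₗ[K] (Fin 5 → K) :=
    LinearMap.pi fun i => (if i = 0 then (-1 : K) else 1) • LinearMap.proj i
  have hs : ∀ v i, s v i = (if i = 0 then (-1 : K) else 1) * v i := by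
    intro v i; rfl
  have hss : ∀ v, s (s v) = v := by
    intro v; funext i; rw [hs, hs]; split_ifs <;> ring
  let S : (Fin 5 → K) ≃ₗ[K] (Fin 5 → K) := LinearEquiv.ofInvolutive s hss
  have hS : ∀ v i, S v i = (if i = 0 then (-1 : K) else 1) * v i := hs
  let R : (Fin 5 → K) ≃ₗ[K] (Fin 5 → K) := (e.symm.trans S).trans e
  have hRv : ∀ v, R v = e (S (e.symm v)) := fun v => rfl
  have hRR : ∀ v, R (R v) = v := by
    intro v
    rw [hRv, hRv, LinearEquiv.symm_apply_apply]
    have : S (S (e.symm v)) = e.symm v := hss _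
    rw [this, LinearEquiv.apply_symm_apply]
  have hRQ : ∀ v, parabolicForm K (R v) = parabolicForm K v := by
    intro v
    have h1 := he (e.symm v)
    rw [LinearEquiv.apply_symm_apply] at h1
    rw [hRv, he, h1]
    simp [hS]
  obtain ⟨r, hr, hr1, hr2, hrv⟩ := exists_aut R hRR hRQ
  have hrc : ∀ x, ∃ a : K, a ≠ 0 ∧ e.symm (vec (r.1 x)) = a • S (e.symm (vec x)) := by
    intro x
    obtain ⟨a, ha, h⟩ := hrv x
    refine ⟨a, ha, ?_⟩
    rw [h, map_smul, hRv, LinearEquiv.symm_apply_apply]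
  have vext : ∀ v w : Fin 5 → K, (∀ i, e.symm v i = e.symm w i) → v = w :=
    fun v w h => e.symm.injective (funext h)
  have rfix : ∀ x ∈ YP, r.1 x = x := by
    intro x hx
    rw [hY] at hx
    obtain ⟨a, ha, h⟩ := hrc x
    apply pt_ext a
    apply vext
    intro i
    rw [h, map_smul, Pi.smul_apply, Pi.smul_apply, hS]
    split_ifs with hi
    · subst hi; rw [hx]; simp
    · simp
  have roff : ∀ x, x ∉ YP → r.1 x ∉ YP := by
    intro x hx hrx
    have := rfix _ hrx
    rw [hr1] at this
    exact hx (this ▸ hrx)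
  -- F2
  have F2 : ∀ x y, x ∉ YP → y ∉ YP → polB (vec x) (vec y) = 0 →
      polB (vec x) (vec (r.1 y)) = 0 → False := by
    intro x y hx hy h1 h3
    rw [hY] at hx hy
    obtain ⟨a, ha, h⟩ := hrc y
    rw [hB] at h1 h3
    rw [h] at h3
    simp [hS] at h3
    have : (2 * 2) * ν * (a * (e.symm (vec x) 0 * e.symm (vec y) 0)) = 0 := by
      linear_combination a * h1 - h3
    simp [h2, hν, ha, hx, hy] at this
  -- F1
  have F1 : ∀ x y, x ∉ YP → (∀ z ∈ YP, polB (vec x) (vec z) = 0 → polB (vec y) (vec z) = 0) →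
      y = x ∨ y = r.1 x := by
    intro x y hx hz
    rw [hY] at hx
    have hQx := hQ x
    have hQy := hQ y
    have hvy := vec_ne y
    have key : ∀ w : Fin 5 → K, w 0 = 0 → w 1 * w 2 + w 3 * w 4 = 0 →
        e.symm (vec x) 1 * w 2 + e.symm (vec x) 2 * w 1 +
        e.symm (vec x) 3 * w 4 + e.symm (vec x) 4 * w 3 = 0 →
        e.symm (vec y) 1 * w 2 + e.symm (vec y) 2 * w 1 +
        e.symm (vec y) 3 * w 4 + e.symm (vec y) 4 * w 3 = 0 := by
      intro w hw0 hwQ hwx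
      by_cases hw : w = 0
      · subst hw; simp
      obtain ⟨z, a, ha, hz'⟩ := exists_pt (e w) (by simpa using hw)
        (by rw [he, hw0]; linear_combination hwQ)
      have hzc : e.symm (vec z) = a • w := by
        rw [hz', map_smul, LinearEquiv.symm_apply_apply]
      have := hz z (by rw [hY, hzc]; simp [hw0]) (by
        rw [hB, hzc]; simp [hw0]; linear_combination a * hwx)
      rw [hB, hzc] at this
      simp [hw0] at this
      have h4 : a * (e.symm (vec y) 1 * w 2 + e.symm (vec y) 2 * w 1 +
        e.symm (vec y) 3 * w 4 + e.symm (vec y) 4 * w 3) = 0 := by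
        linear_combination this
      exact (mul_eq_zero.1 h4).resolve_left ha
    obtain ⟨X, hX⟩ : ∃ X, X = e.symm (vec x) := ⟨_, rfl⟩
    obtain ⟨Y, hYY⟩ : ∃ Y, Y = e.symm (vec y) := ⟨_, rfl⟩
    rw [← hX] at hx hQx
    rw [← hYY] at hQy
    rw [← hX, ← hYY] at key
    have k1 := key ![0, 0, X 4, -X 1, 0] (by simp) (by simp) (by simp; ring)
    have k2 := key ![0, -X 3, 0, 0, X 2] (by simp) (by simp) (by simp; ring)
    have k3 := key ![0, X 1 + X 3, X 4 - X 2, -(X 1 + X 3), X 4 - X 2] (by simp)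
      (by simp; ring) (by simp; ring)
    simp at k1 k2 k3
    have k4 : Y 2 * X 1 + Y 3 * X 4 - Y 1 * X 2 - Y 4 * X 3 = 0 := by
      linear_combination k3 - k1 + k2
    have hdet : X 1 * X 2 + X 3 * X 4 ≠ 0 := by
      intro h
      have : ν * (X 0 * X 0) = 0 := by linear_combination hQx - h
      simp [hν, hx] at this
    -- Y = t X on coordinates 1..4
    obtain ⟨t, ht⟩ : ∃ t, t = (Y 1 * X 2 + Y 4 * X 3) / (X 1 * X 2 + X 3 * X 4) := ⟨_, rfl⟩
    rw [eq_div_iff hdet] at ht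
    have c : ∀ A B : K, (X 1 * X 2 + X 3 * X 4) * A = (X 1 * X 2 + X 3 * X 4) * B → A = B :=
      fun A B h => mul_left_cancel₀ hdet h
    have e1 : Y 1 = t * X 1 := by
      apply c
      linear_combination (-X 1) * ht + X 3 * k1
    have e2 : Y 2 = t * X 2 := by
      apply c
      linear_combination (-X 2) * ht - X 4 * k2 + X 2 * k4
    have e3 : Y 3 = t * X 3 := by
      apply c
      linear_combination (-X 3) * ht + X 1 * k2 + X 3 * k4
    have e4 : Y 4 = t * X 4 := by
      apply c
      linear_combination (-X 4) * ht - X 2 * k1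
    have hsq : (Y 0 - t * X 0) * (Y 0 + t * X 0) = 0 := by
      apply mul_left_cancel₀ hν
      rw [e1, e2, e3, e4] at hQy
      linear_combination hQy - t ^ 2 * hQx
    rcases mul_eq_zero.1 hsq with h | h
    · left
      apply pt_ext t
      apply vext
      intro i
      rw [map_smul, Pi.smul_apply, ← hX, ← hYY, smul_eq_mul]
      fin_cases i
      · exact sub_eq_zero.1 h
      · exact e1
      · exact e2
      · exact e3
      · exact e4
    · right
      obtain ⟨a, ha, hrx⟩ := hrc x
      apply pt_ext (t * a⁻¹)
      apply vext
      intro i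
      rw [map_smul, hrx, smul_smul, mul_assoc, inv_mul_cancel₀ ha, mul_one, Pi.smul_apply,
        ← hX, ← hYY, smul_eq_mul, hS]
      fin_cases i
      · simp; linear_combination h
      · simpa using e1
      · simpa using e2
      · simpa using e3
      · simpa using e4
  -- F3
  have F3 : ∀ x y, x ∉ YP → y ≠ x → y ≠ r.1 x →
      ∃ z, z ∉ YP ∧ polB (vec x) (vec z) = 0 ∧ polB (vec y) (vec z) = 0 := by
    intro x y hx h1 h3
    have : ¬ ∀ z ∈ YP, polB (vec x) (vec z) = 0 → polB (vec y) (vec z) = 0 := by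
      intro h
      rcases F1 x y hx h with h | h
      · exact h1 h
      · exact h3 h
    push Not at this
    obtain ⟨z, hz, hxz, hyz⟩ := this
    have hw0 : e.symm (polB (vec y) (vec z) • vec x + (- polB (vec y) (vec x)) • vec z) 0 ≠ 0 := by
      rw [hY] at hx hz
      rw [map_add, map_smul, map_smul, Pi.add_apply, Pi.smul_apply, Pi.smul_apply, hz]
      simp [hx, hyz]
    obtain ⟨w, a, ha, hw⟩ := exists_pt
      (polB (vec y) (vec z) • vec x + (- polB (vec y) (vec x)) • vec z)
      (by intro h; rw [h] at hw0; simp at hw0)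
      (by rw [pf_add, pf_smul, pf_smul, vec_pf, vec_pf, polB_smul_left, polB_smul_right, hxz]
          ring)
    refine ⟨w, ?_, ?_, ?_⟩
    · rw [hY, hw, map_smul, Pi.smul_apply, smul_eq_mul]
      exact mul_ne_zero ha hw0
    · rw [hw, polB_smul_right, polB_add_right, polB_smul_right, polB_smul_right, hxz, polB_self,
        vec_pf]
      ring
    · rw [hw, polB_smul_right, polB_add_right, polB_smul_right, polB_smul_right]
      ring
  have hex : ∃ x, x ∉ YP := by
    obtain ⟨x, a, ha, hx⟩ := exists_pt (e ![1, 1, -ν, 0, 0])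
      (by
        intro h
        have := congrFun ((map_eq_zero_iff e e.injective).1 h) 0
        simp at this) (by rw [he]; simp)
    refine ⟨x, ?_⟩
    rw [hY, hx, map_smul, LinearEquiv.symm_apply_apply]
    simp [ha]
  have rne : ∀ x, x ∉ YP → r.1 x ≠ x := by
    intro x hx h
    have h0 : polB (vec x) (vec x) = 0 := by rw [polB_self, vec_pf, mul_zero]
    exact F2 x x hx hx h0 (by rw [h]; exact h0)
  have rline : ∀ l ∈ YL, r.2 l = l := by
    intro l hl
    apply line_ext
    · intro x hx
      have h1 : QInc K (r.1 x) l := by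
        have := (hr x (r.2 l)).1 hx
        rwa [hr2] at this
      have h3 := rfix _ (hfull l hl _ h1)
      rw [hr1] at h3
      rwa [← h3] at h1
    · intro x hx
      have := (hr x l).1 hx
      rwa [rfix x (hfull l hl x hx)] at this
  have hid : IsAut (1 : Equiv.Perm (QPoints K) × Equiv.Perm (QLines K)) := fun x l => Iff.rfl
  rw [Nat.card_eq_two_iff]
  refine ⟨⟨1, hid, fun _ _ => rfl, fun _ _ => rfl⟩, ⟨r, hr, rfix, rline⟩, ?_, ?_⟩
  · intro h
    obtain ⟨x, hx⟩ := hex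
    have h' := congrArg Subtype.val h
    apply rne x hx
    have : (1 : Equiv.Perm (QPoints K) × Equiv.Perm (QLines K)).1 x = r.1 x :=
      congrArg (fun g : Equiv.Perm (QPoints K) × Equiv.Perm (QLines K) => g.1 x) h'
    exact this.symm
  · rw [Set.eq_univ_iff_forall]
    rintro ⟨g, hg, hgP, hgL⟩
    have hcases : ∀ x, x ∉ YP → g.1 x = x ∨ g.1 x = r.1 x := by
      intro x hx
      apply F1 x _ hx
      intro z hz hxz
      have := aut_polB hg hxz
      rwa [hgP z hz] at this
    by_cases hfx : ∃ x, x ∉ YP ∧ g.1 x = x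
    · left
      apply Subtype.ext
      apply aut_ext hg hid
      obtain ⟨x, hx, hgx⟩ := hfx
      have step : ∀ x y, x ∉ YP → y ∉ YP → g.1 x = x → polB (vec x) (vec y) = 0 →
          g.1 y = y := by
        intro x y hx hy hgx hxy
        rcases hcases y hy with h | h
        · exact h
        · exfalso
          have := aut_polB hg hxy
          rw [hgx, h] at this
          exact F2 x y hx hy hxy this
      intro y
      change g.1 y = y
      by_cases hy : y ∈ YP
      · exact hgP y hy
      by_cases hyx : y = x
      · rw [hyx, hgx]
      by_cases hyr : y = r.1 x
      · rcases hcases y hy with h | h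
        · exact h
        · exfalso
          rw [hyr, hr1, ← hyr] at h
          exact hyx (g.1.injective (h.trans hgx.symm))
      obtain ⟨z, hz, hxz, hyz⟩ := F3 x y hx hyx hyr
      exact step z y hz hy (step x z hx hz hgx hxz) (by rw [polB_comm]; exact hyz)
    · right
      apply Subtype.ext
      apply aut_ext hg hr
      intro x
      by_cases hx : x ∈ YP
      · rw [hgP x hx, rfix x hx]
      · rcases hcases x hx with h | h
        · exact absurd ⟨x, hx, h⟩ hfx
        · exact h

lemma polB_nondeg (h2 : (2 : K) ≠ 0) {v : Fin 5 → K} (h : ∀ w, polB v w = 0) : v = 0 := by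
  have h0 := h (Pi.single 0 1)
  have h1 := h (Pi.single 1 1)
  have h3 := h (Pi.single 2 1)
  have h4 := h (Pi.single 3 1)
  have h5 := h (Pi.single 4 1)
  simp [polB, h2] at h0 h1 h3 h4 h5
  funext i
  fin_cases i
  · exact h0
  · exact h3
  · exact h1
  · exact h5
  · exact h4

/-- the polar form as a bilinear form -/
def bilB : LinearMap.BilinForm K (Fin 5 → K) :=
  LinearMap.mk₂ K polB (fun u v w => polB_add_left u v w) (fun a v w => polB_smul_left a v w)
    (fun w u v => polB_add_right u v w) (fun a v w => polB_smul_right a v w)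

lemma no_plane (h2 : (2 : K) ≠ 0) {x y z : QPoints K} (W : QLines K) (hy : QInc K y W)
    (hz : QInc K z W) (hx : ¬ QInc K x W) (hyz : y ≠ z)
    (hxy : polB (vec x) (vec y) = 0) (hxz : polB (vec x) (vec z) = 0) : False := by
  have hW := line_span hyz W hy hz
  rw [qinc_iff] at hx
  let U : Submodule K (Fin 5 → K) := W.1 ⊔ Submodule.span K {vec x}
  have hlt : W.1 < U := by
    refine lt_of_le_of_ne le_sup_left ?_
    intro h
    apply hx
    rw [h]
    exact (le_sup_right : _ ≤ U) (Submodule.mem_span_singleton_self _)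
  have h3 : 3 ≤ Module.finrank K U := by
    have := Submodule.finrank_lt_finrank_of_lt hlt
    have h4 : Module.finrank K W.1 = 2 := W.2.1
    omega
  have hxW : ∀ w ∈ W.1, polB (vec x) w = 0 := by
    intro w hw
    rw [hW] at hw
    obtain ⟨s, t, rfl⟩ := Submodule.mem_span_pair.1 hw
    rw [polB_add_right, polB_smul_right, polB_smul_right, hxy, hxz]
    ring
  have hUU : U ≤ bilB.orthogonal U := by
    intro u hu
    rw [LinearMap.BilinForm.mem_orthogonal_iff]
    intro v hv
    change polB v u = 0
    obtain ⟨w, hw, x1, hx1, rfl⟩ := Submodule.mem_sup.1 hu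
    obtain ⟨w', hw', x2, hx2, rfl⟩ := Submodule.mem_sup.1 hv
    obtain ⟨s, rfl⟩ := Submodule.mem_span_singleton.1 hx1
    obtain ⟨t, rfl⟩ := Submodule.mem_span_singleton.1 hx2
    rw [polB_add_left, polB_add_right, polB_add_right, polB_smul_left, polB_smul_left,
      polB_smul_right, polB_smul_right, line_polB W hw' hw, hxW w hw, polB_comm w',
      hxW w' hw', polB_self, vec_pf]
    ring
  have hrefl : (bilB (K := K)).IsRefl := by
    intro u v h
    change polB v u = 0
    rw [polB_comm]; exact h
  have hnd : (bilB (K := K)).Nondegenerate := by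
    refine hrefl.nondegenerate_iff_separatingLeft.2 ?_
    intro v hv
    exact polB_nondeg h2 hv
  have h5 := LinearMap.BilinForm.finrank_orthogonal hnd U
  have h6 := Submodule.finrank_mono hUU
  simp at h5
  omega

lemma frame (h2 : (2 : K) ≠ 0) (a b c d : Fin 5 → K)
    (ha : parabolicForm K a = 0) (hb : parabolicForm K b = 0)
    (hc : parabolicForm K c = 0) (hd : parabolicForm K d = 0)
    (hab : polB a b = 0) (hcd : polB c d = 0) (had : polB a d = 0) (hbc : polB b c = 0)
    (hac : polB a c = 1) (hbd : polB b d = 1) :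
    ∃ ν : K, ν ≠ 0 ∧ ∃ e : (Fin 5 → K) ≃ₗ[K] (Fin 5 → K),
      (∀ v, parabolicForm K (e v) = ν * (v 0 * v 0) + v 1 * v 2 + v 3 * v 4) ∧
      ∃ n, ∀ v, e v = v 0 • n + v 1 • a + v 2 • c + v 3 • b + v 4 • d := by
  obtain ⟨n, hn0, hna, hnb, hnc, hnd⟩ : ∃ n, n ≠ 0 ∧ polB n a = 0 ∧ polB n b = 0 ∧
      polB n c = 0 ∧ polB n d = 0 := by
    let T : (Fin 5 → K) →ₗ[K] (Fin 4 → K) :=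
      LinearMap.pi fun i => bilB (![a, b, c, d] i)
    have hT : T.ker ≠ ⊥ := LinearMap.ker_ne_bot_of_finrank_lt (by simp)
    obtain ⟨n, hn, hn0⟩ := Submodule.exists_mem_ne_zero_of_ne_bot hT
    have hn' : T n = 0 := hn
    refine ⟨n, hn0, ?_, ?_, ?_, ?_⟩ <;> rw [polB_comm]
    · exact congrFun hn' 0
    · exact congrFun hn' 1
    · exact congrFun hn' 2
    · exact congrFun hn' 3
  have e0 : ∃ E : (Fin 5 → K) →ₗ[K] (Fin 5 → K),
      ∀ v, E v = v 0 • n + v 1 • a + v 2 • c + v 3 • b + v 4 • d := by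
    refine ⟨Fintype.linearCombination K ![n, a, c, b, d], fun v => ?_⟩
    simp [Fintype.linearCombination_apply, Fin.sum_univ_five]
  obtain ⟨E, hE⟩ := e0
  have hba := (polB_comm b a).trans hab
  have hdc := (polB_comm d c).trans hcd
  have hda := (polB_comm d a).trans had
  have hcb := (polB_comm c b).trans hbc
  have hca := (polB_comm c a).trans hac
  have hdb := (polB_comm d b).trans hbd
  have saa : polB a a = 0 := by rw [polB_self, ha, mul_zero]
  have sbb : polB b b = 0 := by rw [polB_self, hb, mul_zero]
  have scc : polB c c = 0 := by rw [polB_self, hc, mul_zero]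
  have sdd : polB d d = 0 := by rw [polB_self, hd, mul_zero]
  have hinj : Function.Injective E := by
    rw [injective_iff_map_eq_zero]
    intro v hv
    have z : ∀ w, polB (E v) w = 0 := by
      intro w; rw [hv]; simp [polB]
    simp only [hE, polB_add_left, polB_smul_left] at z
    have z1 := z c
    have z2 := z a
    have z3 := z d
    have z4 := z b
    simp only [hna, hnb, hnc, hnd, hac, hbc, scc, hdc, saa, hba, hca, hda, had, hbd, hcd, sdd,
      hab, hcb, sbb, hdb, mul_zero, mul_one, zero_add, add_zero] at z1 z2 z3 z4
    have h0 := hE v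
    rw [hv, z1, z2, z3, z4] at h0
    simp only [zero_smul, add_zero] at h0
    have h0 := (smul_eq_zero.1 h0.symm).resolve_right hn0
    funext i
    fin_cases i
    · exact h0
    · exact z1
    · exact z2
    · exact z3
    · exact z4
  refine ⟨parabolicForm K n, ?_, LinearEquiv.ofInjectiveEndo E hinj, ?_, n, hE⟩
  · intro h
    apply hn0
    apply polB_nondeg h2
    intro w
    obtain ⟨v, rfl⟩ := (LinearEquiv.ofInjectiveEndo E hinj).surjective w
    change polB n (E v) = 0
    simp only [hE, polB_add_right, polB_smul_right, hna, hnb, hnc, hnd, polB_self, h]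
    ring
  · intro v
    change parabolicForm K (E v) = _
    simp only [hE, pf_add, pf_smul, polB_add_left, polB_smul_left, polB_smul_right, ha, hb, hc,
      hd, hna, hnb, hnc, hnd, hac, hab, had, hcd, hcb, hbd]
    ring

theorem stage1 (h2 : (2 : K) ≠ 0) (q : ℕ) (hq : 0 < q)
    (YP : Set (QPoints K)) (YL : Set (QLines K)) (hne : YP.Nonempty)
    (hsub : IsGQ (Rinc (QInc K) YP YL))
    (hfull : IsFull (QInc K) YP YL)
    (hdeg : ∀ x ∈ YP, {l | l ∈ YL ∧ QInc K x l}.ncard = 2)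
    (hline : ∀ l ∈ YL, {x | QInc K x l}.ncard = q + 1) :
    ∃ ν : K, ν ≠ 0 ∧ ∃ e : (Fin 5 → K) ≃ₗ[K] (Fin 5 → K),
      (∀ v, parabolicForm K (e v) = ν * (v 0 * v 0) + v 1 * v 2 + v 3 * v 4) ∧
      ∀ x, x ∈ YP ↔ e.symm (vec x) 0 = 0 := by
  -- unpacking
  have uniq : ∀ {x y : QPoints K} {l m : QLines K}, x ≠ y → QInc K x l → QInc K y l →
      QInc K x m → QInc K y m → l = m := by
    intro x y l m hxy h1 h3 h4 h5
    apply Subtype.ext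
    rw [line_span hxy l h1 h3, line_span hxy m h4 h5]
  have proj : ∀ x ∈ YP, ∀ l ∈ YL, ¬ QInc K x l →
      ∃ y, QInc K y l ∧ ∃ M ∈ YL, QInc K x M ∧ QInc K y M := by
    intro x hx l hl hxl
    obtain ⟨y, ⟨h1, M, h3, h4⟩, -⟩ := hsub.2.1 ⟨x, hx⟩ ⟨l, hl⟩ hxl
    exact ⟨y.1, h1, M.1, M.2, h3, h4⟩
  have proju : ∀ x ∈ YP, ∀ l ∈ YL, ¬ QInc K x l → ∀ y y', QInc K y l → QInc K y' l →
      ∀ M ∈ YL, ∀ M' ∈ YL, QInc K x M → QInc K y M → QInc K x M' → QInc K y' M' → y = y' := by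
    intro x hx l hl hxl y y' hy hy' M hM M' hM' h1 h3 h4 h5
    have := (hsub.2.1 ⟨x, hx⟩ ⟨l, hl⟩ hxl).unique
      (y₁ := ⟨y, hfull l hl y hy⟩) (y₂ := ⟨y', hfull l hl y' hy'⟩)
      ⟨hy, ⟨M, hM⟩, h1, h3⟩ ⟨hy', ⟨M', hM'⟩, h4, h5⟩
    exact congrArg Subtype.val this
  have other : ∀ x ∈ YP, ∀ l ∈ YL, QInc K x l → ∃ m ∈ YL, QInc K x m ∧ m ≠ l := by
    intro x hx l hl hxl
    obtain ⟨m, hm, hne⟩ := Set.exists_ne_of_one_lt_ncard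
      (by rw [hdeg x hx]; norm_num : 1 < {l | l ∈ YL ∧ QInc K x l}.ncard) l
    exact ⟨m, hm.1, hm.2, hne⟩
  have two : ∀ x ∈ YP, ∀ l ∈ YL, ∀ m ∈ YL, ∀ k ∈ YL, QInc K x l → QInc K x m → QInc K x k →
      m ≠ l → k ≠ l → m = k := by
    intro x hx l hl m hm k hk h1 h3 h4 h5 h6
    obtain ⟨u, w, -, huw⟩ := Set.ncard_eq_two.1 (hdeg x hx)
    have m1 : l ∈ ({u, w} : Set (QLines K)) := huw ▸ ⟨hl, h1⟩
    have m2 : m ∈ ({u, w} : Set (QLines K)) := huw ▸ ⟨hm, h3⟩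
    have m3 : k ∈ ({u, w} : Set (QLines K)) := huw ▸ ⟨hk, h4⟩
    simp only [Set.mem_insert_iff, Set.mem_singleton_iff] at m1 m2 m3
    grind
  have onl : ∀ l ∈ YL, ∀ x, ∃ y, QInc K y l ∧ y ≠ x := by
    intro l hl x
    obtain ⟨m, hm, hne⟩ := Set.exists_ne_of_one_lt_ncard
      (by rw [hline l hl]; omega : 1 < {x | QInc K x l}.ncard) x
    exact ⟨m, hm, hne⟩
  -- the configuration
  obtain ⟨x, hx⟩ := hne
  obtain ⟨l, hl, hxl⟩ : ∃ l ∈ YL, QInc K x l := by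
    obtain ⟨l, h⟩ := hsub.2.2.1 ⟨x, hx⟩
    exact ⟨l.1, l.2, h⟩
  obtain ⟨m, hm, hxm, hml⟩ := other x hx l hl hxl
  obtain ⟨y, hym, hyx⟩ := onl m hm x
  have hy := hfull m hm y hym
  obtain ⟨l', hl', hyl', hl'm⟩ := other y hy m hm hym
  have hxl' : ¬ QInc K x l' := fun h => hl'm (uniq hyx hyl' h hym hxm)
  have hyl : ¬ QInc K y l := fun h => hml (uniq hyx hym hxm h hxl)
  have disj : ∀ z, QInc K z l → ¬ QInc K z l' := by
    intro z hz hz'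
    have : y = z := proju x hx l' hl' hxl' y z hyl' hz' m hm l hl hxm hym hxl hz
    exact hyl (this ▸ hz)
  obtain ⟨x2, hx2l, hx2x⟩ := onl l hl x
  have hx2 := hfull l hl x2 hx2l
  obtain ⟨y2, hy2l', m2, hm2, hx2m2, hy2m2⟩ := proj x2 hx2 l' hl' (disj _ hx2l)
  have hy2y : y2 ≠ y := by
    rintro rfl
    exact hx2x (proju y2 hy l hl hyl x2 x hx2l hxl m2 hm2 m hm hy2m2 hx2m2 hym hxm)
  have B1 : polB (vec x) (vec y) = 0 := collin_polB ⟨m, hxm, hym⟩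
  have B2 : polB (vec x2) (vec y2) = 0 := collin_polB ⟨m2, hx2m2, hy2m2⟩
  have B3 : polB (vec x) (vec x2) = 0 := collin_polB ⟨l, hxl, hx2l⟩
  have B4 : polB (vec y2) (vec y) = 0 := collin_polB ⟨l', hy2l', hyl'⟩
  have N1 : polB (vec x) (vec y2) ≠ 0 := fun h =>
    no_plane h2 l' hy2l' hyl' hxl' hy2y h B1
  have N2 : polB (vec x2) (vec y) ≠ 0 := fun h =>
    no_plane h2 l' hy2l' hyl' (disj _ hx2l) hy2y B2 h
  obtain ⟨α, hα⟩ : ∃ α, α = (polB (vec x) (vec y2))⁻¹ := ⟨_, rfl⟩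
  obtain ⟨β, hβ⟩ : ∃ β, β = (polB (vec x2) (vec y))⁻¹ := ⟨_, rfl⟩
  have hα0 : α ≠ 0 := by rw [hα]; exact inv_ne_zero N1
  have hβ0 : β ≠ 0 := by rw [hβ]; exact inv_ne_zero N2
  obtain ⟨ν, hν, e, he, n, hen⟩ := frame h2 (vec x) (vec x2) (α • vec y2) (β • vec y)
    (vec_pf _) (vec_pf _) (by rw [pf_smul, vec_pf, mul_zero]) (by rw [pf_smul, vec_pf, mul_zero])
    B3 (by rw [polB_smul_left, polB_smul_right, B4]; ring) (by rw [polB_smul_right, B1, mul_zero])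
    (by rw [polB_smul_right, B2, mul_zero]) (by rw [polB_smul_right, hα, inv_mul_cancel₀ N1])
    (by rw [polB_smul_right, hβ, inv_mul_cancel₀ N2])
  refine ⟨ν, hν, e, he, ?_⟩
  let H : Submodule K (Fin 5 → K) := ((LinearMap.proj 0 : (Fin 5 → K) →ₗ[K] K) ∘ₗ
    e.symm.toLinearMap).ker
  have hH : ∀ v, v ∈ H ↔ e.symm v 0 = 0 := fun v => LinearMap.mem_ker
  have hHe : ∀ v, e v ∈ H ↔ v 0 = 0 := by
    intro v; rw [hH, LinearEquiv.symm_apply_apply]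
  have Hx : vec x ∈ H := by
    have := (hHe ![0, 1, 0, 0, 0]).2 (by simp)
    rw [hen] at this
    simpa using this
  have Hx2 : vec x2 ∈ H := by
    have := (hHe ![0, 0, 0, 1, 0]).2 (by simp)
    rw [hen] at this
    simpa using this
  have Hy2 : vec y2 ∈ H := by
    have := (hHe ![0, 0, α⁻¹, 0, 0]).2 (by simp)
    rw [hen] at this
    simpa [smul_smul, hα0] using this
  have Hy : vec y ∈ H := by
    have := (hHe ![0, 0, 0, 0, β⁻¹]).2 (by simp)
    rw [hen] at this
    simpa [smul_smul, hβ0] using this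
  have lineH : ∀ {u w : QPoints K} {M : QLines K}, u ≠ w → QInc K u M → QInc K w M →
      vec u ∈ H → vec w ∈ H → ∀ z, QInc K z M → vec z ∈ H := by
    intro u w M huw hu hw hu' hw' z hz
    rw [qinc_iff, line_span huw M hu hw] at hz
    refine Submodule.span_le.2 ?_ hz
    rintro v (rfl | rfl)
    · exact hu'
    · exact hw'
  have lH := lineH hx2x hx2l hxl Hx2 Hx
  have lpH := lineH hy2y hy2l' hyl' Hy2 Hy
  intro z
  rw [← hH]
  constructor
  · intro hz
    by_cases hzl : QInc K z l
    · exact lH z hzl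
    obtain ⟨u, hul, M, hM, hzM, huM⟩ := proj z hz l hl hzl
    have hu := hfull l hl u hul
    obtain ⟨t, htl', M', hM', huM', htM'⟩ := proj u hu l' hl' (disj u hul)
    have hMM : M = M' := by
      apply two u hu l hl M hM M' hM' hul huM huM'
      · rintro rfl; exact hzl hzM
      · rintro rfl; exact disj t htM' htl'
    subst hMM
    refine lineH (u := u) (w := t) ?_ huM htM' (lH u hul) (lpH t htl') z hzM
    rintro rfl
    exact disj u hul htl'
  · intro hz
    obtain ⟨v, hv⟩ := e.surjective (vec z)
    rw [← hv, hHe] at hz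
    have hQ : v 1 * v 2 + v 3 * v 4 = 0 := by
      have := he v
      rw [hv, vec_pf, hz] at this
      linear_combination -this
    have hvz := hen v
    rw [hv, hz, zero_smul, zero_add] at hvz
    obtain ⟨P, hP⟩ : ∃ P, P = v 1 • vec x + v 3 • vec x2 := ⟨_, rfl⟩
    obtain ⟨T, hT⟩ : ∃ T, T = v 2 • α • vec y2 + v 4 • β • vec y := ⟨_, rfl⟩
    have hzPT : vec z = P + T := by rw [hvz, hP, hT]; abel
    have hPl : P ∈ l.1 := by
      rw [hP]
      exact l.1.add_mem (l.1.smul_mem _ ((qinc_iff _ _).1 hxl))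
        (l.1.smul_mem _ ((qinc_iff _ _).1 hx2l))
    have hTl' : T ∈ l'.1 := by
      rw [hT]
      exact l'.1.add_mem (l'.1.smul_mem _ (l'.1.smul_mem _ ((qinc_iff _ _).1 hy2l')))
        (l'.1.smul_mem _ (l'.1.smul_mem _ ((qinc_iff _ _).1 hyl')))
    by_cases hP0 : P = 0
    · apply hfull l' hl'
      rw [qinc_iff, hzPT, hP0, zero_add]
      exact hTl'
    by_cases hT0 : T = 0
    · apply hfull l hl
      rw [qinc_iff, hzPT, hT0, add_zero]
      exact hPl
    have hPT : polB P T = 0 := by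
      have h1 := pf_add P T
      rw [← hzPT, vec_pf, l.2.2 _ hPl, l'.2.2 _ hTl'] at h1
      simpa using h1.symm
    obtain ⟨u, a, ha, hu⟩ := exists_pt P hP0 (l.2.2 _ hPl)
    obtain ⟨t, b, hb, ht⟩ := exists_pt T hT0 (l'.2.2 _ hTl')
    have hul : QInc K u l := (qinc_of_smul l ha hu).2 hPl
    have htl' : QInc K t l' := (qinc_of_smul l' hb ht).2 hTl'
    obtain ⟨t', htpl, M, hM, huM, htpM⟩ := proj u (hfull l hl u hul) l' hl' (disj u hul)
    have htt : t = t' := by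
      by_contra hne
      refine no_plane h2 l' htl' htpl (disj u hul) hne ?_ (collin_polB ⟨M, huM, htpM⟩)
      rw [hu, ht, polB_smul_left, polB_smul_right, hPT]
      ring
    subst htt
    apply hfull M hM
    rw [qinc_iff, hzPT]
    exact M.1.add_mem ((qinc_of_smul M ha hu).1 huM) ((qinc_of_smul M hb ht).1 htpM)

end helpers

/-- for `q` an odd prime power, the elementwise stabilizer in
`Aut(Q(4,q))` of a full grid `Y = (YP, YL)` of order `(q,1)` has order `2`. -/
theorem elementwise_stabilizer_of_grid_has_order_two
    (p n q : ℕ) (hp : Nat.Prime p) (hodd : Odd p) (hn : 0 < n)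
    (hq : q = p ^ n)
    (K : Type) [Field K] [Fintype K] (hK : Fintype.card K = q)
    (YP : Set (QPoints K)) (YL : Set (QLines K)) (hne : YP.Nonempty)
    (hsub : IsGQ (Rinc (QInc K) YP YL))
    (hfull : IsFull (QInc K) YP YL)
    (hdeg : ∀ x ∈ YP, {l | l ∈ YL ∧ QInc K x l}.ncard = 2)
    (hline : ∀ l ∈ YL, {x | QInc K x l}.ncard = q + 1) :
    Nat.card {g : Equiv.Perm (QPoints K) × Equiv.Perm (QLines K) //
      (∀ x l, QInc K x l ↔ QInc K (g.1 x) (g.2 l)) ∧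
      (∀ x ∈ YP, g.1 x = x) ∧ (∀ l ∈ YL, g.2 l = l)} = 2 := by
  have h2 : (2 : K) ≠ 0 := by
    intro h
    have h1 : ringChar K = 2 := by
      have := ringChar.dvd (R := K) (x := 2) (by exact_mod_cast h)
      rcases (Nat.dvd_prime Nat.prime_two).1 this with h | h
      · exact absurd h CharP.ringChar_ne_one
      · exact h
    have h3 := FiniteField.even_card_iff_char_two.1 h1
    have h4 : Odd (p ^ n) := hodd.pow
    rw [hK, hq] at h3
    rw [Nat.odd_iff] at h4
    omega
  have hq0 : 0 < q := hK ▸ Fintype.card_pos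
  obtain ⟨ν, hν, e, he, hY⟩ := stage1 h2 q hq0 YP YL hne hsub hfull hdeg hline
  exact stage2 h2 ν hν e he YP YL hfull hY
end
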